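/- arXiv:2410.17230 — 4 statements merged into one kernel-verified Lean document; each statement's English description precedes it below -/
import Mathlib

section
/- There is a universal constant C > 0 such that the following holds. Let d, n, k be positive integers with k ≤ d, and let y_1, …, y_n ∈ ℝ^d. Then sup_{M ∈ M_k} (1/n) ∑_{i=1}^n ‖y_i‖_M ≤ C · sup_{V ∈ V_k} (1/n) ∑_{i=1}^n ‖V y_i‖_2. -/
open Matrix Finset

noncomputable section

/-- Euclidean norm on `ℝ^d`. -/
def vnorm {d : ℕ} (x : Fin d → ℝ) : ℝ := Real.sqrt (∑ i, x i ^ 2)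

/-- Mahalanobis norm `‖x‖_M = √(xᵀ M x)`. -/
def mahNorm {d : ℕ} (M : Matrix (Fin d) (Fin d) ℝ) (x : Fin d → ℝ) : ℝ :=
  Real.sqrt (x ⬝ᵥ M.mulVec x)

/-- Frobenius inner product `⟨A,B⟩ = tr(ABᵀ)`. -/
def finner {d : ℕ} (A B : Matrix (Fin d) (Fin d) ℝ) : ℝ := (A * Bᵀ).trace

/-- `V_k`: rank-`k` orthogonal projection matrices. -/
def projSet (d k : ℕ) : Set (Matrix (Fin d) (Fin d) ℝ) :=
  {V | V.IsSymm ∧ V * V = V ∧ V.rank = k}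

/-- `M_k`: symmetric matrices with `0 ⪯ M ⪯ I` and `tr M = k`. -/
def relaxSet (d k : ℕ) : Set (Matrix (Fin d) (Fin d) ℝ) :=
  {M | M.PosSemidef ∧ (1 - M).PosSemidef ∧ M.trace = (k : ℝ)}

/-- Outer product `x xᵀ`. -/
def outerProd {d : ℕ} (x : Fin d → ℝ) : Matrix (Fin d) (Fin d) ℝ := vecMulVec x x

/-- Sample mean of a finite multiset. -/
def mmean {d : ℕ} (S : Multiset (Fin d → ℝ)) : Fin d → ℝ := (S.card : ℝ)⁻¹ • S.sum

/-- Second moment matrix of a finite multiset, centered at `μ`. -/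
def smom {d : ℕ} (S : Multiset (Fin d → ℝ)) (μ : Fin d → ℝ) : Matrix (Fin d) (Fin d) ℝ :=
  (S.card : ℝ)⁻¹ • (S.map (fun x => outerProd (x - μ))).sum

/-- Sample covariance of a finite multiset. -/
def scov {d : ℕ} (S : Multiset (Fin d → ℝ)) : Matrix (Fin d) (Fin d) ℝ := smom S (mmean S)

/-- Operator norm of a matrix. -/
def opNorm {d : ℕ} (A : Matrix (Fin d) (Fin d) ℝ) : ℝ :=
  sSup {r : ℝ | ∃ x : Fin d → ℝ, vnorm x = 1 ∧ r = vnorm (A.mulVec x)}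

/-- `(ε,δ)`-stability of a multiset w.r.t. `μ`. -/
def Stable {d : ℕ} (ε δ : ℝ) (S : Multiset (Fin d → ℝ)) (μ : Fin d → ℝ) : Prop :=
  ∀ S' ≤ S, (1 - ε) * (S.card : ℝ) ≤ (S'.card : ℝ) →
    vnorm (mmean S' - μ) ≤ δ ∧ opNorm (scov S' - 1) ≤ δ ^ 2 / ε

/-- `(ε,δ,k)`-generalized stability of a multiset w.r.t. `μ`. -/
def GenStable {d : ℕ} (ε δ : ℝ) (k : ℕ) (S : Multiset (Fin d → ℝ)) (μ : Fin d → ℝ) : Prop :=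
  ∀ S' ≤ S, (1 - ε) * (S.card : ℝ) ≤ (S'.card : ℝ) →
    vnorm (mmean S' - μ) ≤ δ ∧
    ∀ V ∈ projSet d k, |finner V (smom S' μ - 1)| ≤ δ ^ 2 / ε

/-- The multiset `{x_1, …, x_n}` of an indexed family. -/
def mset {n d : ℕ} (x : Fin n → Fin d → ℝ) : Multiset (Fin d → ℝ) :=
  Multiset.map x (Finset.univ.val)

/-- Couplings between the uniform distributions on `n` and `m` atoms. -/
def couplings (n m : ℕ) : Set (Matrix (Fin n) (Fin m) ℝ) :=
  {π | (∀ i j, 0 ≤ π i j) ∧ (∀ i, ∑ j, π i j = 1 / (n : ℝ)) ∧ (∀ j, ∑ i, π i j = 1 / (m : ℝ))}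

/-- `k`-sliced `p`-Wasserstein distance between (uniform distributions over) two multisets. -/
def slicedW {d : ℕ} (p : ℝ) (k : ℕ) (S T : Multiset (Fin d → ℝ)) : ℝ :=
  ⨆ V ∈ projSet d k, ⨅ π ∈ couplings S.toList.length T.toList.length,
    (∑ i, ∑ j, π i j * vnorm (V.mulVec (S.toList.get i - T.toList.get j)) ^ p) ^ (1 / p)

/-- `(ε,γ)`-PCA-stability of a multiset w.r.t. a PSD matrix `Sg`. -/
def PCAStable {d : ℕ} (ε γ : ℝ) (S : Multiset (Fin d → ℝ))
    (Sg : Matrix (Fin d) (Fin d) ℝ) : Prop :=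
  ∀ S' ≤ S, (1 - ε) * (S.card : ℝ) ≤ (S'.card : ℝ) →
    ((S'.card : ℝ)⁻¹ • (S'.map outerProd).sum - (1 - γ) • Sg).PosSemidef ∧
    ((1 + γ) • Sg - (S'.card : ℝ)⁻¹ • (S'.map outerProd).sum).PosSemidef

/-- The truncated simplex `Δ_{n,ε}`. -/
def simplexEps (n : ℕ) (ε : ℝ) : Set (Fin n → ℝ) :=
  {w | (∀ i, 0 ≤ w i) ∧ (∑ i, w i = 1) ∧ ∀ i, w i ≤ 1 / ((1 - ε) * n)}


lemma bins {ι : Type*} [DecidableEq ι] (k : ℕ) (hk : 0 < k) (l : ι → ℝ) (h0 : ∀ j, 0 ≤ l j)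
    (h1 : ∀ j, l j ≤ 1) (s : Finset ι) (hs : ∑ j ∈ s, l j ≤ k) :
    ∃ g : ι → Fin k, ∀ m, ∑ j ∈ s with g j = m, l j ≤ 2 := by
  induction s using Finset.induction_on with
  | empty => exact ⟨fun _ => ⟨0, hk⟩, by simp⟩
  | insert a s ha ih =>
    rw [Finset.sum_insert ha] at hs
    have hs' : ∑ j ∈ s, l j ≤ k := by linarith [h0 a]
    obtain ⟨g, hg⟩ := ih hs'
    have : ∃ m : Fin k, ∑ j ∈ s with g j = m, l j ≤ 1 := by
      by_contra! hc
      have h2 : ∑ m : Fin k, (1:ℝ) < ∑ m : Fin k, ∑ j ∈ s with g j = m, l j :=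
        Finset.sum_lt_sum_of_nonempty ⟨⟨0, hk⟩, Finset.mem_univ _⟩ (fun m _ => hc m)
      rw [Finset.sum_fiberwise] at h2
      simp at h2
      linarith
    obtain ⟨m0, hm0⟩ := this
    refine ⟨Function.update g a m0, fun m => ?_⟩
    have e : ∑ j ∈ s with Function.update g a m0 j = m, l j = ∑ j ∈ s with g j = m, l j := by
      apply Finset.sum_congr _ (fun _ _ => rfl)
      apply Finset.filter_congr
      intro x hx
      rw [Function.update_of_ne (by rintro rfl; exact ha hx)]
    rw [Finset.filter_insert]
    split_ifs with h
    · rw [Finset.sum_insert (by simp [ha]), e]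
      simp at h
      subst h
      linarith [h1 a]
    · rw [e]; exact hg m

def sg (b : Bool) : ℝ := if b then 1 else -1

lemma sg_sq (b : Bool) : sg b ^ 2 = 1 := by cases b <;> simp [sg]
lemma sg_not (b : Bool) : sg (!b) = - sg b := by cases b <;> simp [sg]

/-- the block sums -/
def bX {d k : ℕ} (g : Fin d → Fin k) (a : Fin d → ℝ) (s : Finset (Fin d)) (e : Fin d → Bool)
    (m : Fin k) : ℝ := ∑ j ∈ s with g j = m, sg (e j) * a j

def bZ {d k : ℕ} (g : Fin d → Fin k) (a : Fin d → ℝ) (s : Finset (Fin d)) (e : Fin d → Bool) : ℝ :=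
  ∑ m, bX g a s e m ^ 2

lemma bZ_nonneg {d k : ℕ} (g : Fin d → Fin k) (a : Fin d → ℝ) (s : Finset (Fin d))
    (e : Fin d → Bool) : 0 ≤ bZ g a s e := Finset.sum_nonneg fun _ _ => sq_nonneg _

lemma bX_insert {d k : ℕ} (g : Fin d → Fin k) (a : Fin d → ℝ) (s : Finset (Fin d)) (j : Fin d)
    (hj : j ∉ s) (e : Fin d → Bool) (m : Fin k) :
    bX g a (insert j s) e m = bX g a s e m + if m = g j then sg (e j) * a j else 0 := by
  unfold bX
  rw [Finset.filter_insert]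
  by_cases h : g j = m
  · rw [if_pos h, if_pos h.symm, Finset.sum_insert (by simp [hj]), add_comm]
  · rw [if_neg h, if_neg (fun h' => h h'.symm), add_zero]

lemma bZ_insert {d k : ℕ} (g : Fin d → Fin k) (a : Fin d → ℝ) (s : Finset (Fin d)) (j : Fin d)
    (hj : j ∉ s) (e : Fin d → Bool) :
    bZ g a (insert j s) e = bZ g a s e + 2 * sg (e j) * a j * bX g a s e (g j) + a j ^ 2 := by
  unfold bZ
  have : ∀ m, bX g a (insert j s) e m ^ 2 = bX g a s e m ^ 2 +
      if m = g j then 2 * sg (e j) * a j * bX g a s e m + a j ^ 2 else 0 := by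
    intro m
    rw [bX_insert g a s j hj]
    split_ifs
    · linear_combination (a j)^2 * sg_sq (e j)
    · ring
  simp only [this, Finset.sum_add_distrib, Finset.sum_ite_eq', Finset.mem_univ, if_true]
  ring

lemma bX_sq_le {d k : ℕ} (g : Fin d → Fin k) (a : Fin d → ℝ) (s : Finset (Fin d))
    (e : Fin d → Bool) (m : Fin k) : bX g a s e m ^ 2 ≤ bZ g a s e :=
  Finset.single_le_sum (f := fun m => bX g a s e m ^ 2) (fun _ _ => sq_nonneg _) (Finset.mem_univ m)

def flp {d : ℕ} (j : Fin d) (e : Fin d → Bool) : Fin d → Bool := Function.update e j (!e j)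

lemma flp_inv {d : ℕ} (j : Fin d) : Function.Involutive (flp j) := by
  intro e; simp [flp]

lemma bX_flp {d k : ℕ} (g : Fin d → Fin k) (a : Fin d → ℝ) (s : Finset (Fin d)) (j : Fin d)
    (hj : j ∉ s) (e : Fin d → Bool) (m : Fin k) : bX g a s (flp j e) m = bX g a s e m := by
  unfold bX
  apply Finset.sum_congr rfl
  intro x hx
  have : x ≠ j := by rintro rfl; simp [hj] at hx
  simp [flp, Function.update_of_ne this]

lemma sum_flp {d : ℕ} (j : Fin d) (f : (Fin d → Bool) → ℝ) :
    ∑ e, f e = ∑ e, (f e + f (flp j e)) / 2 := by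
  have : ∑ e, f (flp j e) = ∑ e, f e := Equiv.sum_comp (flp_inv j).toPerm f
  rw [← Finset.sum_div, Finset.sum_add_distrib, this]; ring

lemma moments {d k : ℕ} (g : Fin d → Fin k) (a : Fin d → ℝ) (s : Finset (Fin d)) :
    ∑ e, bZ g a s e = (2:ℝ)^d * ∑ j ∈ s, a j ^ 2 ∧
    ∑ e, bZ g a s e ^ 2 ≤ (2:ℝ)^d * (3 * (∑ j ∈ s, a j ^ 2) ^ 2) := by
  induction s using Finset.induction_on with
  | empty => simp [bZ, bX]
  | insert j s hj ih =>
    obtain ⟨h1, h2⟩ := ih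
    have hZ : ∀ e, bZ g a s (flp j e) = bZ g a s e := by
      intro e; simp [bZ, bX_flp g a s j hj]
    have hs : ∀ e : Fin d → Bool, sg (flp j e j) = - sg (e j) := by
      intro e; simp [flp, sg_not]
    have hc : ∑ e : Fin d → Bool, (1:ℝ) = 2^d := by simp
    rw [Finset.sum_insert hj]
    set A := ∑ j ∈ s, a j ^ 2
    constructor
    · rw [sum_flp j]
      have : ∀ e, (bZ g a (insert j s) e + bZ g a (insert j s) (flp j e)) / 2 =
          bZ g a s e + a j ^ 2 * 1 := by
        intro e
        rw [bZ_insert g a s j hj, bZ_insert g a s j hj, hZ, hs, bX_flp g a s j hj]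
        ring
      simp only [this, Finset.sum_add_distrib, ← Finset.mul_sum, h1, hc]
      ring
    · rw [sum_flp j]
      have : ∀ e, (bZ g a (insert j s) e ^ 2 + bZ g a (insert j s) (flp j e) ^ 2) / 2 ≤
          bZ g a s e ^ 2 + 6 * a j ^ 2 * bZ g a s e + a j ^ 4 * 1 := by
        intro e
        rw [bZ_insert g a s j hj, bZ_insert g a s j hj, hZ, hs, bX_flp g a s j hj]
        have h := mul_le_mul_of_nonneg_left (bX_sq_le g a s e (g j)) (sq_nonneg (a j))
        have h' := sg_sq (e j)
        have : ((bZ g a s e + 2 * sg (e j) * a j * bX g a s e (g j) + a j ^ 2) ^ 2 +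
          (bZ g a s e + 2 * -sg (e j) * a j * bX g a s e (g j) + a j ^ 2) ^ 2) / 2
          = (bZ g a s e + a j ^ 2)^2 + 4 * (a j ^ 2 * bX g a s e (g j) ^ 2) := by
          linear_combination 4 * (a j)^2 * bX g a s e (g j) ^ 2 * h'
        rw [this]; nlinarith
      refine (Finset.sum_le_sum fun e _ => this e).trans ?_
      simp only [Finset.sum_add_distrib, ← Finset.mul_sum, h1, hc]
      have hp : (0:ℝ) ≤ 2^d := by positivity
      have : (2:ℝ)^d * a j ^ 4 ≥ 0 := by positivity
      nlinarith

lemma sqrt_moment {d k : ℕ} (g : Fin d → Fin k) (a : Fin d → ℝ) :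
    (2:ℝ)^d * (Real.sqrt (∑ j, a j ^ 2) / 2) ≤ ∑ e, Real.sqrt (bZ g a univ e) := by
  obtain ⟨h1, h2⟩ := moments g a univ
  set A := ∑ j, a j ^ 2 with hA
  have hA0 : 0 ≤ A := Finset.sum_nonneg fun _ _ => sq_nonneg _
  rcases hA0.eq_or_lt with h | h
  · rw [← h]; simp; exact Finset.sum_nonneg fun _ _ => Real.sqrt_nonneg _
  set r := Real.sqrt A with hr
  have hr0 : 0 < r := Real.sqrt_pos.2 h
  have hrA : A = r ^ 2 := (Real.sq_sqrt hA0).symm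
  have key : ∀ e, r⁻¹ * bZ g a univ e - (r⁻¹)^3 / 6 * bZ g a univ e ^ 2
      ≤ Real.sqrt (bZ g a univ e) := by
    intro e
    set t := Real.sqrt (bZ g a univ e) with ht
    have ht0 : 0 ≤ t := Real.sqrt_nonneg _
    rw [← Real.sq_sqrt (bZ_nonneg g a univ e), ← ht]
    set u := r⁻¹ * t with hu
    have hu0 : 0 ≤ u := by positivity
    have : u - u^3/6 ≤ 1 := by nlinarith [mul_nonneg hu0 (sq_nonneg (u - 3/2)), sq_nonneg (u-3/2), sq_nonneg (u - 1)]
    have := mul_le_mul_of_nonneg_left this ht0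
    calc _ = t * (u - u^3/6) := by rw [hu]; ring
      _ ≤ t := by linarith
  have := Finset.sum_le_sum fun e (_ : e ∈ univ) => key e
  refine le_trans ?_ this
  rw [Finset.sum_sub_distrib, ← Finset.mul_sum, ← Finset.mul_sum, h1]
  have h3 := mul_le_mul_of_nonneg_left h2 (by positivity : 0 ≤ (r⁻¹)^3 / 6)
  refine le_trans (le_of_eq ?_) (sub_le_sub_left h3 _)
  rw [hrA]; field_simp; norm_num

lemma vnorm_eq {d : ℕ} (x : Fin d → ℝ) : vnorm x = ‖WithLp.toLp 2 x‖ := by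
  rw [EuclideanSpace.norm_eq]; simp [vnorm]

lemma extend_sub {d k : ℕ} (W : Submodule ℝ (EuclideanSpace ℝ (Fin d)))
    (hW : Module.finrank ℝ W ≤ k) (hk : k ≤ d) :
    ∃ U : Submodule ℝ (EuclideanSpace ℝ (Fin d)), W ≤ U ∧ Module.finrank ℝ U = k := by
  induction k, hW using Nat.le_induction with
  | base => exact ⟨W, le_rfl, rfl⟩
  | succ m hm ih =>
    obtain ⟨U, hU, hr⟩ := ih (by omega)
    have hne : U ≠ ⊤ := by
      rintro rfl
      simp at hr
      omega
    obtain ⟨x, -, hx⟩ := SetLike.exists_of_lt (lt_top_iff_ne_top.2 hne)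
    exact ⟨U ⊔ Submodule.span ℝ {x}, hU.trans le_sup_left,
      by rw [Submodule.finrank_sup_span_singleton hx, hr]⟩

lemma exists_proj {d k : ℕ} (hk : k ≤ d) (w : Fin k → EuclideanSpace ℝ (Fin d))
    (ho : ∀ m m', m ≠ m' → inner ℝ (w m) (w m') = 0) (hn : ∀ m, inner ℝ (w m) (w m) ≤ 2) :
    ∃ V ∈ projSet d k, ∀ y : Fin d → ℝ,
      ∑ m, (inner ℝ (w m) (WithLp.toLp 2 y)) ^ 2 ≤ 2 * vnorm (V.mulVec y) ^ 2 := by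
  obtain ⟨U, hWU, hU⟩ := extend_sub (Submodule.span ℝ (Set.range w))
    (by
      have h := finrank_range_le_card (R := ℝ) w
      rw [Fintype.card_fin] at h
      exact h) hk
  set L : EuclideanSpace ℝ (Fin d) →ₗ[ℝ] EuclideanSpace ℝ (Fin d) := U.starProjection.toLinearMap
    with hL
  set V := Matrix.toEuclideanLin.symm L with hV
  have hVL : Matrix.toEuclideanLin V = L := by simp [hV]
  refine ⟨V, ⟨?_, ?_, ?_⟩, ?_⟩
  · have : V.IsHermitian := by
      rw [← Matrix.isSymmetric_toEuclideanLin_iff, hVL]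
      exact U.starProjection_isSymmetric
    rw [Matrix.IsHermitian, Matrix.conjTranspose_eq_transpose_of_trivial] at this
    exact this
  · have hLL : ∀ x, L (L x) = L x := fun x => by
      have := U.isIdempotentElem_starProjection
      exact congrArg (fun f => f x) this
    apply Matrix.toEuclideanLin.injective
    ext1 x
    have := hLL x
    rw [← hVL] at this
    rw [← this]
    simp [Matrix.toEuclideanLin_apply, Matrix.mulVec_mulVec]
  · rw [Matrix.rank_eq_finrank_range_toLin V (EuclideanSpace.basisFun (Fin d) ℝ).toBasis
      (EuclideanSpace.basisFun (Fin d) ℝ).toBasis, ← Matrix.toEuclideanLin_eq_toLin_orthonormal,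
      hVL, hL]
    rw [show LinearMap.range (U.starProjection.toLinearMap) = U from U.range_starProjection]
    exact hU
  · intro y
    have e1 : vnorm (V.mulVec y) = ‖L (WithLp.toLp 2 y)‖ := by
      rw [vnorm_eq, ← hVL]; rfl
    rw [e1]
    set Y := WithLp.toLp 2 y
    have e2 : ∀ m, inner ℝ (w m) Y = inner ℝ (w m) (L Y) := by
      intro m
      have hm : w m ∈ U := hWU (Submodule.subset_span ⟨m, rfl⟩)
      have := U.inner_starProjection_left_eq_right (w m) Y
      rw [U.starProjection_eq_self_iff.2 hm] at this
      exact this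
    simp only [e2]
    set z := L Y
    set c : Fin k → ℝ := fun m => inner ℝ (w m) z
    set p := ∑ m, c m • w m with hp
    have hzp : inner ℝ z p = ∑ m, c m ^ 2 := by
      rw [hp, inner_sum]
      apply Finset.sum_congr rfl
      intro m _
      rw [inner_smul_right, real_inner_comm]; ring
    have hpp : inner ℝ p p ≤ 2 * ∑ m, c m ^ 2 := by
      rw [hp, sum_inner, Finset.mul_sum]
      apply Finset.sum_le_sum
      intro m _
      rw [inner_sum, Finset.sum_eq_single m]
      · rw [inner_smul_left, inner_smul_right]
        simp only [conj_trivial]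
        nlinarith [mul_le_mul_of_nonneg_left (hn m) (sq_nonneg (c m))]
      · intro m' _ h
        rw [inner_smul_left, inner_smul_right, ho m m' h.symm]; simp
      · simp
    have h0 : 0 ≤ ‖z - (1/2 : ℝ) • p‖ ^ 2 := sq_nonneg _
    rw [norm_sub_sq_real, norm_smul, inner_smul_right, mul_pow, ← real_inner_self_eq_norm_sq p,
      hzp] at h0
    rw [real_inner_self_eq_norm_sq] at hpp h0
    norm_num at h0
    change ∑ m, c m ^ 2 ≤ _
    linarith

lemma inner_combo {d : ℕ} {E : Type*} [NormedAddCommGroup E] [InnerProductSpace ℝ E]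
    (b : OrthonormalBasis (Fin d) ℝ E) (c c' : Fin d → ℝ) (s t : Finset (Fin d)) :
    inner ℝ (∑ j ∈ s, c j • b j) (∑ j ∈ t, c' j • b j) = ∑ j ∈ s ∩ t, c j * c' j := by
  rw [sum_inner, ← Finset.sum_filter_add_sum_filter_not s (· ∈ t), Finset.filter_mem_eq_inter]
  have h : ∀ j, inner ℝ (c j • b j) (∑ i ∈ t, c' i • b i) = if j ∈ t then c j * c' j else 0 := by
    intro j
    rw [inner_sum]
    simp only [inner_smul_left, inner_smul_right, conj_trivial,
      orthonormal_iff_ite.1 b.orthonormal]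
    simp [mul_comm]
  simp only [h]
  rw [Finset.sum_congr rfl (g := fun j => c j * c' j), add_eq_left]
  · apply Finset.sum_eq_zero
    intro j hj
    simp at hj
    simp [hj.2]
  · intro j hj
    simp at hj
    simp [hj.2]

lemma main_bound {d n k : ℕ} (hk0 : 0 < k) (hk : k ≤ d) (y : Fin n → Fin d → ℝ)
    (M : Matrix (Fin d) (Fin d) ℝ) (hM : M ∈ relaxSet d k) :
    ∃ V ∈ projSet d k, ∑ i, mahNorm M (y i) ≤ 4 * ∑ i, vnorm (V.mulVec (y i)) := by
  obtain ⟨hp, h1p, htr⟩ := hM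
  set hH := hp.isHermitian
  set l := hH.eigenvalues
  set b := hH.eigenvectorBasis
  have hl0 : ∀ j, 0 ≤ l j := hp.eigenvalues_nonneg
  have hbb : ∀ j, (b j).ofLp ⬝ᵥ (b j).ofLp = 1 := by
    intro j
    have := orthonormal_iff_ite.1 b.orthonormal j j
    rw [EuclideanSpace.inner_eq_star_dotProduct, if_pos rfl] at this
    exact this
  have hl1 : ∀ j, l j ≤ 1 := by
    intro j
    have := h1p.dotProduct_mulVec_nonneg (b j).ofLp
    rw [Matrix.sub_mulVec, hH.mulVec_eigenvectorBasis j, dotProduct_sub, Matrix.one_mulVec,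
      dotProduct_smul] at this
    change 0 ≤ (b j).ofLp ⬝ᵥ (b j).ofLp - l j • ((b j).ofLp ⬝ᵥ (b j).ofLp) at this
    rw [hbb] at this
    simp at this
    exact this
  have hsum : ∑ j, l j = k := by
    rw [← htr, hH.trace_eq_sum_eigenvalues]; simp [l]
  obtain ⟨g, hg⟩ := bins k hk0 l hl0 hl1 univ hsum.le
  set a : Fin n → Fin d → ℝ := fun i j => Real.sqrt (l j) * inner ℝ (b j) (WithLp.toLp 2 (y i))
    with ha
  have hmah : ∀ i, mahNorm M (y i) = Real.sqrt (∑ j, a i j ^ 2) := by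
    intro i
    unfold mahNorm
    congr 1
    have h3 : y i ⬝ᵥ M *ᵥ y i = inner ℝ (WithLp.toLp 2 (y i)) (WithLp.toLp 2 (M *ᵥ y i)) := by
      simp [EuclideanSpace.inner_eq_star_dotProduct, dotProduct_comm]
    rw [h3, ← b.sum_inner_mul_inner]
    apply Finset.sum_congr rfl
    intro j _
    have h4 : inner ℝ (b j) (WithLp.toLp 2 (M *ᵥ y i)) = l j * inner ℝ (b j) (WithLp.toLp 2 (y i)) := by
      have hs := (Matrix.isSymmetric_toEuclideanLin_iff.2 hH) (b j) (WithLp.toLp 2 (y i))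
      rw [Matrix.toEuclideanLin_apply, hH.mulVec_eigenvectorBasis j] at hs
      rw [Matrix.toEuclideanLin_apply] at hs
      rw [← hs, WithLp.toLp_smul, inner_smul_left]
      rfl
    rw [h4, ha, mul_pow, Real.sq_sqrt (hl0 j), real_inner_comm]
    ring
  -- averaging over signs
  have hex : ∃ e : Fin d → Bool, ∑ i, Real.sqrt (∑ j, a i j ^ 2) / 2 ≤
      ∑ i, Real.sqrt (bZ g (a i) univ e) := by
    have : ∑ e : Fin d → Bool, ∑ i, Real.sqrt (∑ j, a i j ^ 2) / 2 ≤
        ∑ e : Fin d → Bool, ∑ i, Real.sqrt (bZ g (a i) univ e) := by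
      rw [Finset.sum_comm, Finset.sum_comm (s := (univ : Finset (Fin d → Bool)))]
      apply Finset.sum_le_sum
      intro i _
      simpa using sqrt_moment g (a i)
    obtain ⟨e, -, he⟩ := Finset.exists_le_of_sum_le Finset.univ_nonempty this
    exact ⟨e, he⟩
  obtain ⟨e, he⟩ := hex
  set c : Fin d → ℝ := fun j => sg (e j) * Real.sqrt (l j) with hc
  obtain ⟨V, hV, hVy⟩ := exists_proj hk (fun m => ∑ j with g j = m, c j • b j)
    (by
      intro m m' h
      rw [inner_combo]
      apply Finset.sum_eq_zero
      intro j hj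
      simp at hj
      exact absurd (hj.1.symm.trans hj.2) h)
    (by
      intro m
      rw [inner_combo, Finset.inter_self]
      refine le_trans (le_of_eq ?_) (hg m)
      apply Finset.sum_congr rfl
      intro j _
      have := Real.sq_sqrt (hl0 j)
      have h2 := sg_sq (e j)
      simp only [hc]
      linear_combination Real.sqrt (l j) ^ 2 * h2 + this)
  refine ⟨V, hV, ?_⟩
  have hZ : ∀ i, Real.sqrt (bZ g (a i) univ e) ≤ 2 * vnorm (V.mulVec (y i)) := by
    intro i
    have hv : 0 ≤ vnorm (V.mulVec (y i)) := Real.sqrt_nonneg _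
    apply Real.sqrt_le_iff.2 ⟨by positivity, ?_⟩
    have : bZ g (a i) univ e ≤ 2 * vnorm (V.mulVec (y i)) ^ 2 := by
      refine le_trans (le_of_eq ?_) (hVy (y i))
      unfold bZ bX
      apply Finset.sum_congr rfl
      intro m _
      congr 1
      rw [sum_inner]
      apply Finset.sum_congr rfl
      intro j _
      rw [inner_smul_left]
      simp [hc, ha]
      ring
    nlinarith [sq_nonneg (vnorm (V.mulVec (y i)))]
  have := he.trans (Finset.sum_le_sum fun i _ => hZ i)
  rw [← Finset.sum_div, ← Finset.mul_sum] at this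
  simp only [hmah]
  linarith

lemma vnorm_proj_le {d k : ℕ} (V : Matrix (Fin d) (Fin d) ℝ) (hV : V ∈ projSet d k)
    (x : Fin d → ℝ) : vnorm (V.mulVec x) ≤ vnorm x := by
  obtain ⟨hs, hi, -⟩ := hV
  have hsym : V.IsHermitian := by
    rw [Matrix.IsHermitian, Matrix.conjTranspose_eq_transpose_of_trivial]
    exact hs
  rw [vnorm_eq, vnorm_eq]
  have h1 := (Matrix.isSymmetric_toEuclideanLin_iff.2 hsym) (WithLp.toLp 2 x)
    (Matrix.toEuclideanLin V (WithLp.toLp 2 x))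
  have h2 : Matrix.toEuclideanLin V (Matrix.toEuclideanLin V (WithLp.toLp 2 x)) =
    Matrix.toEuclideanLin V (WithLp.toLp 2 x) := by
    simp [Matrix.toEuclideanLin_apply, Matrix.mulVec_mulVec, hi]
  rw [h2] at h1
  change ‖Matrix.toEuclideanLin V (WithLp.toLp 2 x)‖ ≤ _
  set z := Matrix.toEuclideanLin V (WithLp.toLp 2 x)
  have h3 := real_inner_le_norm (WithLp.toLp 2 x) z
  rw [← h1, real_inner_self_eq_norm_sq] at h3
  by_contra! hc
  nlinarith [norm_nonneg z, norm_nonneg (WithLp.toLp 2 x)]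

/-- bound on averages of generalized projection norms by averages of
projection norms. -/
theorem stmt_0 :
    ∃ C : ℝ, 0 < C ∧
      ∀ (d n k : ℕ), 0 < d → 0 < n → 0 < k → k ≤ d →
        ∀ y : Fin n → Fin d → ℝ,
          (⨆ M ∈ relaxSet d k, (n : ℝ)⁻¹ * ∑ i, mahNorm M (y i)) ≤
            C * ⨆ V ∈ projSet d k, (n : ℝ)⁻¹ * ∑ i, vnorm (V.mulVec (y i)) := by
  refine ⟨4, by norm_num, ?_⟩
  intro d n k hd hn hk hkd y
  have hR : ∀ V ∈ projSet d k, (n : ℝ)⁻¹ * ∑ i, vnorm (V.mulVec (y i)) ≤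
      ⨆ V ∈ projSet d k, (n : ℝ)⁻¹ * ∑ i, vnorm (V.mulVec (y i)) := by
    intro V hV
    have hb : BddAbove (Set.range fun V : Matrix (Fin d) (Fin d) ℝ =>
        ⨆ _ : V ∈ projSet d k, (n : ℝ)⁻¹ * ∑ i, vnorm (V.mulVec (y i))) := by
      refine ⟨(n : ℝ)⁻¹ * ∑ i, vnorm (y i), ?_⟩
      rintro _ ⟨V, rfl⟩
      refine Real.iSup_le (fun hV => ?_) ?_
      · gcongr with i _
        exact vnorm_proj_le V hV _
      · exact mul_nonneg (by positivity) (Finset.sum_nonneg fun _ _ => Real.sqrt_nonneg _)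
    refine le_trans (le_of_eq ?_) (le_ciSup hb V)
    have : Nonempty (V ∈ projSet d k) := ⟨hV⟩
    exact (ciSup_const).symm
  have hnn : 0 ≤ ⨆ V ∈ projSet d k, (n : ℝ)⁻¹ * ∑ i, vnorm (V.mulVec (y i)) :=
    Real.iSup_nonneg fun V => Real.iSup_nonneg fun _ =>
      mul_nonneg (by positivity) (Finset.sum_nonneg fun _ _ => Real.sqrt_nonneg _)
  refine Real.iSup_le (fun M => Real.iSup_le (fun hM => ?_) ?_) ?_
  · obtain ⟨V, hV, h⟩ := main_bound hk hkd y M hM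
    have h1 := mul_le_mul_of_nonneg_left h (by positivity : (0:ℝ) ≤ (n:ℝ)⁻¹)
    have h2 := hR V hV
    linarith
  · positivity
  · positivity

end
end

section
/- There is a universal constant C > 0 such that the following holds. Let d, n, k be positive integers with k ≤ d, let ρ > 0, ε ∈ (0,1), and let z_1, …, z_n ∈ ℝ^d satisfy max_{V ∈ V_k} (1/n) ∑_{i=1}^n ‖V z_i‖_2 ≤ ρ. Then there exists a subset I ⊆ {1,…,n} with |I| ≥ (1−ε)n such that max_{M ∈ M_k} (1/|I|) ∑_{i∈I} z_iᵀ M z_i ≤ C ρ²/ε. Moreover, for any subset I ⊆ {1,…,n}, max_{V ∈ V_k} (1/|I|) ∑_{i∈I} ‖V z_i‖_2² = max_{M ∈ M_k} (1/|I|) ∑_{i∈I} z_iᵀ M z_i. -/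
open Matrix Finset

noncomputable section

namespace Aux1

lemma spec {d : ℕ} (A : Matrix (Fin d) (Fin d) ℝ) (hA : A.IsHermitian) :
    ∃ (U : Matrix (Fin d) (Fin d) ℝ) (a : Fin d → ℝ), Uᵀ * U = 1 ∧ U * Uᵀ = 1 ∧
      A = U * diagonal a * Uᵀ := by
  refine ⟨hA.eigenvectorUnitary, hA.eigenvalues, ?_, ?_, ?_⟩
  · have := Unitary.coe_star_mul_self hA.eigenvectorUnitary
    rwa [star_eq_conjTranspose, conjTranspose_eq_transpose_of_trivial] at this
  · have := Unitary.coe_mul_star_self hA.eigenvectorUnitary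
    rwa [Unitary.coe_star, star_eq_conjTranspose, conjTranspose_eq_transpose_of_trivial] at this
  · have := hA.spectral_theorem
    rw [Unitary.conjStarAlgAut_apply, star_eq_conjTranspose,
      conjTranspose_eq_transpose_of_trivial] at this
    exact this

lemma quad_diag {d : ℕ} (U : Matrix (Fin d) (Fin d) ℝ) (a : Fin d → ℝ) (z : Fin d → ℝ) :
    z ⬝ᵥ (U * diagonal a * Uᵀ).mulVec z = ∑ j, a j * (Uᵀ.mulVec z j) ^ 2 := by
  rw [← mulVec_mulVec, ← mulVec_mulVec, dotProduct_mulVec, ← mulVec_transpose]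
  simp only [dotProduct, mulVec_diagonal]
  exact Finset.sum_congr rfl fun j _ => by ring

lemma conj_diag {d : ℕ} (U : Matrix (Fin d) (Fin d) ℝ) (a : Fin d → ℝ) (hU : Uᵀ * U = 1)
    (j : Fin d) : (fun i => U i j) ⬝ᵥ (U * diagonal a * Uᵀ).mulVec (fun i => U i j) = a j := by
  rw [quad_diag]
  have : ∀ l, Uᵀ.mulVec (fun i => U i j) l = (1 : Matrix (Fin d) (Fin d) ℝ) l j := by
    intro l; rw [← hU]; simp [mulVec, dotProduct, mul_apply]
  simp [this, one_apply]

lemma col_norm {d : ℕ} (U : Matrix (Fin d) (Fin d) ℝ) (hU : Uᵀ * U = 1)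
    (j : Fin d) : (fun i => U i j) ⬝ᵥ (fun i => U i j) = 1 := by
  have := congrFun (congrFun hU j) j
  simpa [mul_apply, dotProduct] using this

lemma quad_nonneg {d k : ℕ} {M : Matrix (Fin d) (Fin d) ℝ} (hM : M ∈ relaxSet d k)
    (z : Fin d → ℝ) : 0 ≤ z ⬝ᵥ M.mulVec z := by
  simpa using hM.1.dotProduct_mulVec_nonneg z

lemma quad_le {d k : ℕ} {M : Matrix (Fin d) (Fin d) ℝ} (hM : M ∈ relaxSet d k)
    (z : Fin d → ℝ) : z ⬝ᵥ M.mulVec z ≤ z ⬝ᵥ z := by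
  have := hM.2.1.dotProduct_mulVec_nonneg z
  simp [sub_mulVec] at this
  exact this

lemma trace_diag {d : ℕ} (U : Matrix (Fin d) (Fin d) ℝ) (a : Fin d → ℝ) (hU : Uᵀ * U = 1) :
    (U * diagonal a * Uᵀ).trace = ∑ j, a j := by
  rw [trace_mul_comm, ← Matrix.mul_assoc, hU, Matrix.one_mul, trace_diagonal]

/-- spectral decomposition of elements of the relaxed set -/
lemma relax_spec {d k : ℕ} {M : Matrix (Fin d) (Fin d) ℝ} (hM : M ∈ relaxSet d k) :
    ∃ (U : Matrix (Fin d) (Fin d) ℝ) (a : Fin d → ℝ), Uᵀ * U = 1 ∧ U * Uᵀ = 1 ∧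
      M = U * diagonal a * Uᵀ ∧ (∀ j, 0 ≤ a j) ∧ (∀ j, a j ≤ 1) ∧ ∑ j, a j = k := by
  obtain ⟨U, a, h1, h2, h3⟩ := spec M hM.1.1
  refine ⟨U, a, h1, h2, h3, fun j => ?_, fun j => ?_, ?_⟩
  · rw [← conj_diag U a h1 j, ← h3]; exact quad_nonneg hM _
  · rw [← conj_diag U a h1 j, ← h3, ← col_norm U h1 j]; exact quad_le hM _
  · rw [← trace_diag U a h1, ← h3]; exact hM.2.2

lemma vnorm_sq {d : ℕ} (x : Fin d → ℝ) : vnorm x ^ 2 = x ⬝ᵥ x := by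
  rw [vnorm, Real.sq_sqrt (Finset.sum_nonneg fun _ _ => sq_nonneg _)]
  simp [dotProduct, sq]

lemma proj_quad {d k : ℕ} {V : Matrix (Fin d) (Fin d) ℝ} (hV : V ∈ projSet d k)
    (z : Fin d → ℝ) : vnorm (V.mulVec z) ^ 2 = z ⬝ᵥ V.mulVec z := by
  rw [vnorm_sq, dotProduct_mulVec, ← mulVec_transpose, hV.1.eq, mulVec_mulVec, hV.2.1,
    dotProduct_comm]

lemma proj_relax {d k : ℕ} {V : Matrix (Fin d) (Fin d) ℝ} (hV : V ∈ projSet d k) :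
    V ∈ relaxSet d k := by
  have hH : V.IsHermitian := by
    rw [IsHermitian, conjTranspose_eq_transpose_of_trivial]; exact hV.1
  refine ⟨?_, ?_, ?_⟩
  · have := posSemidef_conjTranspose_mul_self V
    rwa [hH.eq, hV.2.1] at this
  · have := posSemidef_conjTranspose_mul_self (1 - V)
    rw [conjTranspose_sub, hH.eq, conjTranspose_one] at this
    have e : (1 - V) * (1 - V) = 1 - V := by
      rw [Matrix.mul_sub, Matrix.sub_mul, Matrix.sub_mul, hV.2.1]; simp
    rwa [e] at this
  · have h1 : IsIdempotentElem (Matrix.toLin' V) := by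
      rw [IsIdempotentElem, Module.End.mul_eq_comp, ← Matrix.toLin'_mul, hV.2.1]
    have h2 := (LinearMap.IsIdempotentElem.isProj_range _ h1).trace
    rw [Matrix.trace_toLin'_eq] at h2
    rw [h2, ← hV.2.2, Matrix.rank, Matrix.toLin'_apply']

lemma mk_proj {d k : ℕ} (U : Matrix (Fin d) (Fin d) ℝ) (hU : Uᵀ * U = 1) (S : Finset (Fin d))
    (hS : S.card = k) :
    U * diagonal (fun j => if j ∈ S then (1:ℝ) else 0) * Uᵀ ∈ projSet d k := by
  refine ⟨?_, ?_, ?_⟩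
  · rw [IsSymm, transpose_mul, transpose_mul, transpose_transpose, diagonal_transpose,
      Matrix.mul_assoc]
  · have : U * diagonal (fun j => if j ∈ S then (1:ℝ) else 0) * Uᵀ *
        (U * diagonal (fun j => if j ∈ S then (1:ℝ) else 0) * Uᵀ) =
        U * (diagonal (fun j => if j ∈ S then (1:ℝ) else 0) * (Uᵀ * U) *
          diagonal (fun j => if j ∈ S then (1:ℝ) else 0)) * Uᵀ := by
      simp only [Matrix.mul_assoc]
    rw [this, hU, Matrix.mul_one, diagonal_mul_diagonal]
    congr 3
    funext j
    by_cases hj : j ∈ S <;> simp [hj]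
  · have hd : IsUnit U.det := by
      have := congrArg det hU
      rw [det_mul, det_transpose, det_one] at this
      exact IsUnit.of_mul_eq_one _ this
    rw [rank_mul_eq_left_of_isUnit_det _ _ (by rwa [det_transpose]),
      rank_mul_eq_right_of_isUnit_det _ _ hd, rank_diagonal, ← hS]
    simp

lemma mk_proj_quad {d : ℕ} (U : Matrix (Fin d) (Fin d) ℝ) (S : Finset (Fin d)) (z : Fin d → ℝ) :
    z ⬝ᵥ (U * diagonal (fun j => if j ∈ S then (1:ℝ) else 0) * Uᵀ).mulVec z =
      ∑ j ∈ S, (Uᵀ.mulVec z j) ^ 2 := by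
  rw [quad_diag]; simp [Finset.sum_ite_mem]

/-- linear programming over the truncated simplex -/
lemma lp {d k : ℕ} (hk : 0 < k) (hkd : k ≤ d) (a m : Fin d → ℝ) (h0 : ∀ j, 0 ≤ m j)
    (h1 : ∀ j, m j ≤ 1) (hs : ∑ j, m j = k) :
    ∃ S : Finset (Fin d), S.card = k ∧ ∑ j, a j * m j ≤ ∑ j ∈ S, a j := by
  have hne : (Finset.powersetCard k (Finset.univ : Finset (Fin d))).Nonempty :=
    Finset.powersetCard_nonempty.2 (by simpa using hkd)
  obtain ⟨S, hS, hmax⟩ := Finset.exists_max_image _ (fun S => ∑ j ∈ S, a j) hne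
  have hc := (Finset.mem_powersetCard.1 hS).2
  refine ⟨S, hc, ?_⟩
  have hSne : S.Nonempty := by rw [← Finset.card_pos]; omega
  obtain ⟨p, hp, hpmin⟩ := Finset.exists_min_image S a hSne
  have hout : ∀ j ∉ S, a j ≤ a p := by
    intro j hj
    have hj' : j ∉ S.erase p := fun h => hj (Finset.mem_of_mem_erase h)
    have := hmax (insert j (S.erase p)) (by
      rw [Finset.mem_powersetCard]
      refine ⟨Finset.subset_univ _, ?_⟩
      rw [Finset.card_insert_of_notMem hj', Finset.card_erase_of_mem hp]; omega)
    simp only [Finset.sum_insert hj'] at this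
    have h2 := Finset.add_sum_erase S a hp
    linarith
  have e1 : ∑ j ∈ S, a j = ∑ j, a j * (if j ∈ S then 1 else 0) := by
    simp [Finset.sum_ite_mem]
  have e2 : ∑ j, (if j ∈ S then (1:ℝ) else 0) = k := by
    simp [hc]
  have key : ∑ j, (a j - a p) * (m j - if j ∈ S then 1 else 0) ≤ 0 := by
    apply Finset.sum_nonpos
    intro j _
    by_cases hj : j ∈ S
    · simp only [hj, if_true]
      nlinarith [hpmin j hj, h1 j]
    · simp only [hj, if_false]
      nlinarith [hout j hj, h0 j]
  have e3 : ∑ j, (a j - a p) * (m j - if j ∈ S then 1 else 0) =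
      ∑ j, a j * m j - ∑ j, a j * (if j ∈ S then 1 else 0)
        - a p * (∑ j, m j - ∑ j, (if j ∈ S then (1:ℝ) else 0)) := by
    rw [← Finset.sum_sub_distrib, ← Finset.sum_sub_distrib, Finset.mul_sum,
      ← Finset.sum_sub_distrib]
    exact Finset.sum_congr rfl fun j _ => by ring
  rw [e3, hs, e2] at key
  rw [e1]; linarith

/-- Ky Fan -/
lemma kyfan {d n k : ℕ} (hk : 0 < k) (hkd : k ≤ d) (z : Fin n → Fin d → ℝ) (I : Finset (Fin n))
    {M : Matrix (Fin d) (Fin d) ℝ} (hM : M ∈ relaxSet d k) :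
    ∃ V ∈ projSet d k, ∑ i ∈ I, (z i) ⬝ᵥ M.mulVec (z i) ≤ ∑ i ∈ I, (z i) ⬝ᵥ V.mulVec (z i) := by
  have htr : ∀ N : Matrix (Fin d) (Fin d) ℝ,
      ∑ i ∈ I, (z i) ⬝ᵥ N.mulVec (z i) = (N * ∑ i ∈ I, vecMulVec (z i) (z i)).trace := by
    intro N
    rw [Matrix.mul_sum, trace_sum]
    refine Finset.sum_congr rfl fun i _ => ?_
    rw [mul_vecMulVec, trace_vecMulVec, dotProduct_comm]
  set A := ∑ i ∈ I, vecMulVec (z i) (z i) with hA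
  have hAH : A.IsHermitian := by
    rw [IsHermitian, conjTranspose_eq_transpose_of_trivial, hA, transpose_sum]
    exact Finset.sum_congr rfl fun i _ => by rw [transpose_vecMulVec]
  obtain ⟨U, a, h1, h2, h3⟩ := spec A hAH
  have htr2 : ∀ N : Matrix (Fin d) (Fin d) ℝ, (N * A).trace =
      ∑ j, a j * ((fun i => U i j) ⬝ᵥ N.mulVec (fun i => U i j)) := by
    intro N
    rw [h3, ← Matrix.mul_assoc, trace_mul_comm, ← Matrix.mul_assoc, ← Matrix.mul_assoc, trace]
    refine Finset.sum_congr rfl fun j _ => ?_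
    rw [diag_apply, mul_diagonal, mul_comm, Matrix.mul_assoc, mul_apply]
    rfl
  obtain ⟨S, hS, hle⟩ := lp hk hkd a (fun j => (fun i => U i j) ⬝ᵥ M.mulVec (fun i => U i j))
    (fun j => quad_nonneg hM _) (fun j => by rw [← col_norm U h1 j]; exact quad_le hM _) (by
      rw [← hM.2.2, ← Matrix.mul_one M, ← h2, ← Matrix.mul_assoc, trace_mul_comm,
        ← Matrix.mul_assoc, trace]
      refine Finset.sum_congr rfl fun j _ => ?_
      rw [diag_apply, Matrix.mul_assoc, Matrix.mul_assoc, mul_apply, h2, Matrix.mul_one]; rfl)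
  refine ⟨_, mk_proj U h1 S hS, ?_⟩
  rw [htr, htr, htr2, htr2]
  refine hle.trans (le_of_eq ?_)
  simp only [conj_diag U _ h1]
  simp [Finset.sum_ite_mem]

lemma sup_le_sup {α : Type*} {A B : Set α} {f g : α → ℝ} {c : ℝ} (hg0 : ∀ b ∈ B, 0 ≤ g b)
    (hgc : ∀ b ∈ B, g b ≤ c) (hfg : ∀ x ∈ A, ∃ b ∈ B, f x ≤ g b) :
    (⨆ x ∈ A, f x) ≤ ⨆ b ∈ B, g b := by
  have hin : ∀ b ∈ B, (⨆ _ : b ∈ B, g b) = g b := fun b hb => by simp [hb]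
  have hout : ∀ b ∉ B, (⨆ _ : b ∈ B, g b) = 0 := fun b hb => by simp [hb]
  have hnn : 0 ≤ ⨆ b ∈ B, g b := by
    apply Real.iSup_nonneg
    intro b
    by_cases hb : b ∈ B
    · rw [hin b hb]; exact hg0 b hb
    · rw [hout b hb]
  have hbdd : BddAbove (Set.range fun b => ⨆ _ : b ∈ B, g b) := by
    refine ⟨max c 0, ?_⟩
    rintro _ ⟨b, rfl⟩
    by_cases hb : b ∈ B
    · simp only [hin b hb]; exact (hgc b hb).trans (le_max_left _ _)
    · simp only [hout b hb]; exact le_max_right _ _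
  refine Real.iSup_le (fun x => Real.iSup_le (fun hx => ?_) hnn) hnn
  obtain ⟨b, hb, h⟩ := hfg x hx
  refine h.trans ?_
  rw [← hin b hb]
  exact le_ciSup hbdd b

lemma part2 {d n k : ℕ} (hk : 0 < k) (hkd : k ≤ d) (z : Fin n → Fin d → ℝ) (I : Finset (Fin n)) :
    (⨆ V ∈ projSet d k, (I.card : ℝ)⁻¹ * ∑ i ∈ I, vnorm (V.mulVec (z i)) ^ 2) =
      ⨆ M ∈ relaxSet d k, (I.card : ℝ)⁻¹ * ∑ i ∈ I, (z i) ⬝ᵥ M.mulVec (z i) := by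
  have hc : (0:ℝ) ≤ (I.card : ℝ)⁻¹ := by positivity
  have hb : ∀ M ∈ relaxSet d k, (I.card : ℝ)⁻¹ * ∑ i ∈ I, (z i) ⬝ᵥ M.mulVec (z i) ≤
      (I.card : ℝ)⁻¹ * ∑ i ∈ I, (z i) ⬝ᵥ z i := fun M hM =>
    mul_le_mul_of_nonneg_left (Finset.sum_le_sum fun i _ => quad_le hM _) hc
  have he : ∀ V ∈ projSet d k, ∑ i ∈ I, vnorm (V.mulVec (z i)) ^ 2 =
      ∑ i ∈ I, (z i) ⬝ᵥ V.mulVec (z i) := fun V hV =>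
    Finset.sum_congr rfl fun i _ => proj_quad hV _
  apply le_antisymm
  · refine sup_le_sup (c := (I.card : ℝ)⁻¹ * ∑ i ∈ I, (z i) ⬝ᵥ z i) ?_ hb ?_
    · exact fun M hM => mul_nonneg hc (Finset.sum_nonneg fun i _ => quad_nonneg hM _)
    · intro V hV
      exact ⟨V, proj_relax hV, by rw [he V hV]⟩
  · refine sup_le_sup (c := (I.card : ℝ)⁻¹ * ∑ i ∈ I, (z i) ⬝ᵥ z i) ?_ ?_ ?_
    · intro V hV; positivity
    · intro V hV
      rw [he V hV]; exact hb V (proj_relax hV)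
    · intro M hM
      obtain ⟨V, hV, h⟩ := kyfan hk hkd z I hM
      refine ⟨V, hV, ?_⟩
      rw [he V hV]
      exact mul_le_mul_of_nonneg_left h hc

/-- the real sign attached to a unit of `ℤ` -/
def sg {d : ℕ} (s : Fin d → ℤˣ) (j : Fin d) : ℝ := ((s j : ℤ) : ℝ)

lemma sg_sq {d : ℕ} (s : Fin d → ℤˣ) (j : Fin d) : sg s j * sg s j = 1 := by
  rcases Int.units_eq_one_or (s j) with h | h <;> simp [sg, h]

/-- flip one sign -/
def flip {d : ℕ} (j : Fin d) (s : Fin d → ℤˣ) : Fin d → ℤˣ :=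
  Pi.mulSingle j (-1) * s

lemma sg_flip_self {d : ℕ} (j : Fin d) (s : Fin d → ℤˣ) : sg (flip j s) j = - sg s j := by
  simp [sg, flip]

lemma sg_flip_ne {d : ℕ} {j l : Fin d} (h : l ≠ j) (s : Fin d → ℤˣ) :
    sg (flip j s) l = sg s l := by
  simp [sg, flip, Pi.mulSingle_eq_of_ne h]

lemma sum_flip {d : ℕ} (j : Fin d) (f : (Fin d → ℤˣ) → ℝ) : ∑ s, f (flip j s) = ∑ s, f s :=
  Equiv.sum_comp (Equiv.mulLeft (Pi.mulSingle j (-1) : Fin d → ℤˣ)) f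

lemma K24 {d : ℕ} (x : Fin d → EuclideanSpace ℝ (Fin d)) (t : Finset (Fin d)) :
    ∑ s : Fin d → ℤˣ, ‖∑ j ∈ t, sg s j • x j‖ ^ 2 =
      (Fintype.card (Fin d → ℤˣ) : ℝ) * ∑ j ∈ t, ‖x j‖ ^ 2 ∧
    ∑ s : Fin d → ℤˣ, ‖∑ j ∈ t, sg s j • x j‖ ^ 4 ≤
      3 * (Fintype.card (Fin d → ℤˣ) : ℝ) * (∑ j ∈ t, ‖x j‖ ^ 2) ^ 2 := by
  induction t using Finset.induction_on with
  | empty => simp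
  | insert p t hp ih =>
    obtain ⟨ih2, ih4⟩ := ih
    set N : ℝ := (Fintype.card (Fin d → ℤˣ) : ℝ) with hN
    have hN0 : 0 ≤ N := by positivity
    set σ : ℝ := ∑ j ∈ t, ‖x j‖ ^ 2 with hσ
    set T : (Fin d → ℤˣ) → EuclideanSpace ℝ (Fin d) := fun s => ∑ j ∈ t, sg s j • x j with hT
    have hTf : ∀ s, T (flip p s) = T s := fun s =>
      Finset.sum_congr rfl fun j hj => by
        rw [sg_flip_ne]; rintro rfl; exact hp hj
    have hins : ∀ s, ∑ j ∈ insert p t, sg s j • x j = sg s p • x p + T s := fun s =>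
      Finset.sum_insert hp
    have hexp : ∀ s, ‖sg s p • x p + T s‖ ^ 2 =
        ‖T s‖ ^ 2 + ‖x p‖ ^ 2 + 2 * sg s p * inner ℝ (x p) (T s) := by
      intro s
      rw [norm_add_sq_real, norm_smul, mul_pow, Real.norm_eq_abs, sq_abs, sq (sg s p), sg_sq,
        real_inner_smul_left]; ring
    have hcs : ∀ s, (inner ℝ (x p) (T s)) ^ 2 ≤ ‖x p‖ ^ 2 * ‖T s‖ ^ 2 := by
      intro s
      rw [← mul_pow, ← sq_abs (inner ℝ (x p) (T s))]
      exact pow_le_pow_left₀ (abs_nonneg _) (abs_real_inner_le_norm _ _) 2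
    have hcard : ∑ _s : Fin d → ℤˣ, (1:ℝ) = N := by simp [hN]
    simp only [hins, Finset.sum_insert hp]
    rw [← hσ]
    constructor
    · have h1 := sum_flip p (fun s => ‖sg s p • x p + T s‖ ^ 2)
      have h2 : ∑ s, (‖sg (flip p s) p • x p + T (flip p s)‖ ^ 2 + ‖sg s p • x p + T s‖ ^ 2) =
          ∑ s, (2 * ‖T s‖ ^ 2 + 2 * ‖x p‖ ^ 2 * 1) := by
        refine Finset.sum_congr rfl fun s _ => ?_
        rw [hexp, hexp, hTf, sg_flip_self]; ring
      rw [Finset.sum_add_distrib, Finset.sum_add_distrib, ← Finset.mul_sum, ← Finset.mul_sum,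
        hcard, ih2] at h2
      linarith
    · have h1 := sum_flip p (fun s => ‖sg s p • x p + T s‖ ^ 4)
      have h2 : ∑ s, (‖sg (flip p s) p • x p + T (flip p s)‖ ^ 4 + ‖sg s p • x p + T s‖ ^ 4) ≤
          ∑ s, (2 * ‖T s‖ ^ 4 + 12 * ‖x p‖ ^ 2 * ‖T s‖ ^ 2 + 2 * ‖x p‖ ^ 4 * 1) := by
        refine Finset.sum_le_sum fun s _ => ?_
        have e : ∀ y : EuclideanSpace ℝ (Fin d), ‖y‖ ^ 4 = (‖y‖ ^ 2) ^ 2 := fun y => by ring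
        rw [e, e (sg s p • x p + T s), hexp, hexp, hTf, sg_flip_self]
        have h3 := hcs s
        have h4 := sg_sq s p
        have h5 : (sg s p * inner ℝ (x p) (T s)) ^ 2 = (inner ℝ (x p) (T s)) ^ 2 := by
          rw [mul_pow, sq (sg s p), h4, one_mul]
        nlinarith
      rw [Finset.sum_add_distrib, Finset.sum_add_distrib, Finset.sum_add_distrib,
        ← Finset.mul_sum, ← Finset.mul_sum, ← Finset.mul_sum, hcard, ih2] at h2
      have h6 : 0 ≤ N * ‖x p‖ ^ 4 := by positivity
      nlinarith

lemma K1 {d : ℕ} (x : Fin d → EuclideanSpace ℝ (Fin d)) :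
    (Fintype.card (Fin d → ℤˣ) : ℝ) * Real.sqrt (∑ j, ‖x j‖ ^ 2) ≤
      4 * ∑ s : Fin d → ℤˣ, ‖∑ j, sg s j • x j‖ := by
  obtain ⟨h2, h4⟩ := K24 x Finset.univ
  set N : ℝ := (Fintype.card (Fin d → ℤˣ) : ℝ) with hN
  have hσ0 : 0 ≤ ∑ j, ‖x j‖ ^ 2 := by positivity
  set r := Real.sqrt (∑ j, ‖x j‖ ^ 2) with hr
  have hr2 : ∑ j, ‖x j‖ ^ 2 = r ^ 2 := (Real.sq_sqrt hσ0).symm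
  rw [hr2] at h2 h4
  have hr0 : 0 ≤ r := Real.sqrt_nonneg _
  rcases hr0.eq_or_lt with h0 | hpos
  · rw [← h0]; simp only [mul_zero]; positivity
  have hpt : ∀ u : ℝ, 0 ≤ u → 4 * r ^ 2 * u ^ 2 - u ^ 4 ≤ 4 * r ^ 3 * u := by
    intro u hu
    have : 0 ≤ u ^ 3 - 4 * u * r ^ 2 + 4 * r ^ 3 := by
      have h7 : 0 ≤ (u - 6/5 * r) ^ 2 * (u + 12/5 * r) := by positivity
      have h8 : 0 ≤ u * r ^ 2 := by positivity
      have h9 : 0 ≤ r ^ 3 := by positivity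
      nlinarith
    nlinarith [mul_nonneg hu this]
  have hsum : ∑ s : Fin d → ℤˣ, (4 * r ^ 2 * ‖∑ j, sg s j • x j‖ ^ 2 - ‖∑ j, sg s j • x j‖ ^ 4) ≤
      ∑ s : Fin d → ℤˣ, 4 * r ^ 3 * ‖∑ j, sg s j • x j‖ :=
    Finset.sum_le_sum fun s _ => hpt _ (norm_nonneg _)
  rw [Finset.sum_sub_distrib, ← Finset.mul_sum, ← Finset.mul_sum, h2] at hsum
  have h10 : r ^ 3 * (N * r) ≤ r ^ 3 * (4 * ∑ s : Fin d → ℤˣ, ‖∑ j, sg s j • x j‖) := by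
    nlinarith
  exact le_of_mul_le_mul_left h10 (by positivity)

lemma bins {d k : ℕ} (hk : 0 < k) (a : Fin d → ℝ) (h0 : ∀ j, 0 ≤ a j)
    (h1 : ∀ j, a j ≤ 1) (hs : ∑ j, a j = k) (K : Finset (Fin d)) (hK : K.card = k) :
    ∃ b : Fin d → Fin d, (∀ j, b j ∈ K) ∧ ∀ l, (∑ j, if b j = l then a j else 0) ≤ 2 := by
  have main : ∀ t : Finset (Fin d), ∃ b : Fin d → Fin d, (∀ j, b j ∈ K) ∧
      ∀ l, (∑ j ∈ t, if b j = l then a j else 0) ≤ 2 := by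
    intro t
    induction t using Finset.induction_on with
    | empty =>
      obtain ⟨p, hp⟩ : K.Nonempty := by rw [← Finset.card_pos]; omega
      exact ⟨fun _ => p, fun _ => hp, by simp⟩
    | insert p t hp ih =>
      obtain ⟨b, hb, hl⟩ := ih
      obtain ⟨q, hq, hq1⟩ : ∃ q ∈ K, (∑ j ∈ t, if b j = q then a j else 0) ≤ 1 := by
        by_contra! hcon
        have hne : K.Nonempty := by rw [← Finset.card_pos]; omega
        have h2 := Finset.sum_lt_sum_of_nonempty hne hcon
        rw [Finset.sum_comm] at h2
        have h3 : ∑ j ∈ t, ∑ q ∈ K, (if b j = q then a j else 0) = ∑ j ∈ t, a j :=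
          Finset.sum_congr rfl fun j _ => by simp [hb j]
        rw [h3] at h2
        have h4 : ∑ j ∈ t, a j ≤ ∑ j, a j :=
          Finset.sum_le_sum_of_subset_of_nonneg (Finset.subset_univ _) fun j _ _ => h0 j
        simp [hK] at h2
        linarith
      refine ⟨Function.update b p q, ?_, ?_⟩
      · intro j
        by_cases hj : j = p
        · subst hj; simpa using hq
        · simpa [hj] using hb j
      · intro l
        rw [Finset.sum_insert hp]
        have h5 : ∑ j ∈ t, (if Function.update b p q j = l then a j else 0) =
            ∑ j ∈ t, (if b j = l then a j else 0) :=
          Finset.sum_congr rfl fun j hj => by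
            have : j ≠ p := by rintro rfl; exact hp hj
            simp [this]
        rw [h5]
        by_cases hql : q = l
        · subst hql; simp; linarith [h1 p]
        · simp [hql]; exact hl l
  exact main Finset.univ

lemma inner_toLp {d : ℕ} (u w : Fin d → ℝ) :
    inner ℝ (WithLp.toLp 2 u : EuclideanSpace ℝ (Fin d)) (WithLp.toLp 2 w) = u ⬝ᵥ w := by
  rw [EuclideanSpace.inner_toLp_toLp, dotProduct_comm]; simp

lemma ext_proj {d k : ℕ} (v : Fin d → Fin d → ℝ) (ho : ∀ l m, l ≠ m → v l ⬝ᵥ v m = 0)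
    (h2 : ∀ l, v l ⬝ᵥ v l ≤ 2) (K : Finset (Fin d)) (hK : K.card = k) :
    ∃ V ∈ projSet d k, ∀ z : Fin d → ℝ, ∑ l ∈ K, (v l ⬝ᵥ z) ^ 2 ≤ 2 * vnorm (V.mulVec z) ^ 2 := by
  let w : Fin d → EuclideanSpace ℝ (Fin d) := fun l =>
    (Real.sqrt (v l ⬝ᵥ v l))⁻¹ • WithLp.toLp 2 (v l)
  let s : Set (Fin d) := {l | 0 < v l ⬝ᵥ v l}
  have hw : Orthonormal ℝ (s.domRestrict w) := by
    rw [orthonormal_iff_ite]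
    rintro ⟨l, hl⟩ ⟨m, hm⟩
    simp only [Set.domRestrict_apply, w, real_inner_smul_left, real_inner_smul_right, inner_toLp]
    have hl' : 0 < v l ⬝ᵥ v l := hl
    by_cases h : l = m
    · subst h
      have := Real.mul_self_sqrt hl'.le
      have h3 : Real.sqrt (v l ⬝ᵥ v l) ≠ 0 := (Real.sqrt_pos.2 hl').ne'
      simp only [if_true]
      nth_rewrite 3 [← this]
      field_simp
    · simp [h, ho l m h]
  obtain ⟨B, hB⟩ := hw.exists_orthonormalBasis_extension_of_card_eq (by simp)
  obtain ⟨U, hUe⟩ : ∃ U : Matrix (Fin d) (Fin d) ℝ, ∀ i l, U i l = B l i :=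
    ⟨Matrix.of fun i l => B l i, fun _ _ => rfl⟩
  have hU : Uᵀ * U = 1 := by
    ext l m
    have := orthonormal_iff_ite.1 B.orthonormal l m
    rw [one_apply, ← this, mul_apply]
    simp [hUe, PiLp.inner_apply, mul_comm]
  have hV := mk_proj U hU K hK
  refine ⟨_, hV, fun z => ?_⟩
  rw [proj_quad hV, mk_proj_quad, Finset.mul_sum]
  refine Finset.sum_le_sum fun l _ => ?_
  by_cases hl : 0 < v l ⬝ᵥ v l
  · have hBl : ∀ i, B l i = (Real.sqrt (v l ⬝ᵥ v l))⁻¹ * v l i := by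
      intro i; rw [hB l hl]; simp [w]
    have e : Uᵀ.mulVec z l = (Real.sqrt (v l ⬝ᵥ v l))⁻¹ * (v l ⬝ᵥ z) := by
      simp only [mulVec, dotProduct, transpose_apply, hUe, hBl]
      rw [Finset.mul_sum]
      exact Finset.sum_congr rfl fun i _ => by ring
    rw [e, mul_pow, inv_pow, Real.sq_sqrt hl.le, ← mul_assoc, ← div_eq_mul_inv]
    have : 1 ≤ 2 / (v l ⬝ᵥ v l) := by rw [le_div_iff₀ hl]; linarith [h2 l]
    nlinarith [sq_nonneg (v l ⬝ᵥ z)]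
  · have h0 : v l ⬝ᵥ v l = 0 := le_antisymm (not_lt.1 hl) (by
      simp only [dotProduct]; exact Finset.sum_nonneg fun i _ => mul_self_nonneg _)
    rw [dotProduct_self_eq_zero.1 h0]
    simp; positivity

/-- rounding from the relaxed set to projections -/
lemma rounding {d n k : ℕ} (hk : 0 < k) (hkd : k ≤ d) (z : Fin n → Fin d → ℝ) (R : ℝ)
    (hz : ∀ V ∈ projSet d k, ∑ i, vnorm (V.mulVec (z i)) ≤ R)
    {M : Matrix (Fin d) (Fin d) ℝ} (hM : M ∈ relaxSet d k) :
    ∑ i, Real.sqrt (z i ⬝ᵥ M.mulVec (z i)) ≤ 6 * R := by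
  obtain ⟨U, a, hU, -, hMe, ha0, ha1, has⟩ := relax_spec hM
  obtain ⟨K, -, hK⟩ := Finset.exists_subset_card_eq (s := (Finset.univ : Finset (Fin d))) (n := k)
    (by simpa using hkd)
  obtain ⟨b, hbK, hb2⟩ := bins hk a ha0 ha1 has K hK
  let v : (Fin d → ℤˣ) → Fin d → Fin d → ℝ := fun s l =>
    U.mulVec (fun j => if b j = l then sg s j * Real.sqrt (a j) else 0)
  have hdot : ∀ x y : Fin d → ℝ, U.mulVec x ⬝ᵥ U.mulVec y = x ⬝ᵥ y := by
    intro x y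
    rw [dotProduct_mulVec, ← mulVec_transpose, mulVec_mulVec, hU, one_mulVec]
  have hvz : ∀ s l (y : Fin d → ℝ), v s l ⬝ᵥ y =
      ∑ j, if b j = l then sg s j * Real.sqrt (a j) * Uᵀ.mulVec y j else 0 := by
    intro s l y
    rw [dotProduct_comm, dotProduct_mulVec, ← mulVec_transpose, dotProduct_comm]
    simp only [dotProduct, ite_mul, zero_mul]
  have hV : ∀ s, ∃ V ∈ projSet d k, ∀ y : Fin d → ℝ,
      ∑ l ∈ K, (v s l ⬝ᵥ y) ^ 2 ≤ 2 * vnorm (V.mulVec y) ^ 2 := by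
    intro s
    apply ext_proj _ _ _ K hK
    · intro l m hlm
      simp only [v]
      rw [hdot]
      simp only [dotProduct]
      refine Finset.sum_eq_zero fun j _ => ?_
      by_cases h : b j = l
      · have : b j ≠ m := by rw [h]; exact hlm
        simp [this]
      · simp [h]
    · intro l
      simp only [v]
      rw [hdot]
      simp only [dotProduct]
      refine le_trans (le_of_eq ?_) (hb2 l)
      refine Finset.sum_congr rfl fun j _ => ?_
      by_cases h : b j = l
      · simp only [h, if_true]
        have h1 := sg_sq s j
        have h2 := Real.mul_self_sqrt (ha0 j)
        calc _ = (sg s j * sg s j) * (Real.sqrt (a j) * Real.sqrt (a j)) := by ring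
          _ = _ := by rw [h1, h2, one_mul]
      · simp [h]
  choose V hVp hVz using hV
  set N : ℝ := (Fintype.card (Fin d → ℤˣ) : ℝ) with hN
  have hNpos : 0 < N := by
    have : 0 < Fintype.card (Fin d → ℤˣ) := Fintype.card_pos
    rw [hN]; exact_mod_cast this
  have hi : ∀ i, N * Real.sqrt (z i ⬝ᵥ M.mulVec (z i)) ≤
      ∑ s, 6 * vnorm ((V s).mulVec (z i)) := by
    intro i
    let x : Fin d → EuclideanSpace ℝ (Fin d) := fun j =>
      EuclideanSpace.single (b j) (Real.sqrt (a j) * Uᵀ.mulVec (z i) j)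
    have hx := K1 x
    have e1 : ∑ j, ‖x j‖ ^ 2 = z i ⬝ᵥ M.mulVec (z i) := by
      rw [hMe, quad_diag]
      refine Finset.sum_congr rfl fun j _ => ?_
      simp only [x, EuclideanSpace.norm_single]
      rw [Real.norm_eq_abs, sq_abs, mul_pow, Real.sq_sqrt (ha0 j)]
    rw [e1] at hx
    refine hx.trans ?_
    rw [Finset.mul_sum]
    refine Finset.sum_le_sum fun s _ => ?_
    have e2 : ‖∑ j, sg s j • x j‖ ^ 2 = ∑ l ∈ K, (v s l ⬝ᵥ z i) ^ 2 := by
      rw [EuclideanSpace.norm_sq_eq]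
      have e3 : ∀ l, (∑ j, sg s j • x j) l = v s l ⬝ᵥ z i := by
        intro l
        rw [hvz, WithLp.ofLp_sum, Finset.sum_apply]
        refine Finset.sum_congr rfl fun j _ => ?_
        by_cases h : b j = l
        · simp [x, h]; ring
        · have h' : l ≠ b j := fun e => h e.symm
          simp [x, h, h']
      simp only [e3, Real.norm_eq_abs, sq_abs]
      symm
      apply Finset.sum_subset (Finset.subset_univ _)
      intro l _ hl
      rw [hvz, Finset.sum_eq_zero, sq, zero_mul]
      intro j _
      rw [if_neg]; rintro rfl; exact hl (hbK j)
    have h3 := hVz s (z i)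
    rw [← e2] at h3
    have h4 : 0 ≤ vnorm ((V s).mulVec (z i)) := Real.sqrt_nonneg _
    refine abs_le_of_sq_le_sq' ?_ (by positivity) |>.2
    nlinarith
  have htot : N * ∑ i, Real.sqrt (z i ⬝ᵥ M.mulVec (z i)) ≤ N * (6 * R) := by
    calc _ = ∑ i, N * Real.sqrt (z i ⬝ᵥ M.mulVec (z i)) := Finset.mul_sum _ _ _
      _ ≤ ∑ i, ∑ s, 6 * vnorm ((V s).mulVec (z i)) := Finset.sum_le_sum fun i _ => hi i
      _ = ∑ s, 6 * ∑ i, vnorm ((V s).mulVec (z i)) := by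
        rw [Finset.sum_comm]; simp only [Finset.mul_sum]
      _ ≤ ∑ _s : Fin d → ℤˣ, 6 * R := Finset.sum_le_sum fun s _ => by
        linarith [hz (V s) (hVp s)]
      _ = _ := by simp [hN]
  exact le_of_mul_le_mul_left htot hNpos

lemma first_order {n : ℕ} (a h : Fin n → ℝ) (ha : ∀ i, 0 < a i)
    (hmax : ∀ t : ℝ, 0 < t → t ≤ 1 → ∑ i, Real.sqrt (a i + t * h i) ≤ ∑ i, Real.sqrt (a i)) :
    ∑ i, h i / Real.sqrt (a i) ≤ 0 := by
  have hd : HasDerivAt (fun t : ℝ => ∑ i, Real.sqrt (a i + t * h i))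
      (∑ i, h i / (2 * Real.sqrt (a i))) 0 := by
    apply HasDerivAt.fun_sum
    intro i _
    have h1 : HasDerivAt (fun t : ℝ => a i + t * h i) (h i) 0 := by
      simpa using ((hasDerivAt_id (0:ℝ)).mul_const (h i)).const_add (a i)
    have h2 := h1.sqrt (by simpa using (ha i).ne')
    simpa using h2
  have hslope := (hd.hasDerivWithinAt (s := Set.Ioi 0))
  rw [hasDerivWithinAt_iff_tendsto_slope' (by simp)] at hslope
  have hle : ∑ i, h i / (2 * Real.sqrt (a i)) ≤ 0 := by
    refine le_of_tendsto hslope ?_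
    filter_upwards [Ioc_mem_nhdsGT (zero_lt_one' ℝ)] with t ht
    rw [slope_def_field]
    apply div_nonpos_of_nonpos_of_nonneg
    · have := hmax t ht.1 ht.2
      simpa using this
    · linarith [ht.1]
  have : ∑ i, h i / (2 * Real.sqrt (a i)) = (1/2) * ∑ i, h i / Real.sqrt (a i) := by
    rw [Finset.mul_sum]
    exact Finset.sum_congr rfl fun i _ => by ring
  rw [this] at hle; linarith

lemma psd_iff {d : ℕ} (M : Matrix (Fin d) (Fin d) ℝ) :
    M.PosSemidef ↔ Mᵀ = M ∧ ∀ x : Fin d → ℝ, 0 ≤ x ⬝ᵥ M.mulVec x := by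
  rw [posSemidef_iff_dotProduct_mulVec, IsHermitian, conjTranspose_eq_transpose_of_trivial]
  simp

lemma quad_continuous {d : ℕ} (x : Fin d → ℝ) :
    Continuous fun M : Matrix (Fin d) (Fin d) ℝ => x ⬝ᵥ M.mulVec x := by
  fun_prop

lemma psd_closed {d : ℕ} : IsClosed {M : Matrix (Fin d) (Fin d) ℝ | M.PosSemidef} := by
  simp only [psd_iff, Set.setOf_and, Set.setOf_forall]
  refine IsClosed.inter (isClosed_eq (by fun_prop) (by fun_prop)) (isClosed_iInter fun x => ?_)
  exact isClosed_le continuous_const (quad_continuous x)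

lemma relax_entry {d k : ℕ} {M : Matrix (Fin d) (Fin d) ℝ} (hM : M ∈ relaxSet d k)
    (i j : Fin d) : M i j ∈ Set.Icc (-1 : ℝ) 1 := by
  have hs : M j i = M i j := by
    have := congrFun (congrFun ((psd_iff M).1 hM.1).1 i) j
    simpa using this
  have h1 := quad_nonneg hM (Pi.single i 1 + Pi.single j 1)
  have h2 := quad_nonneg hM (Pi.single i 1 - Pi.single j 1)
  have h3 := quad_le hM (Pi.single i 1)
  have h4 := quad_le hM (Pi.single j 1)
  simp [mulVec_add, mulVec_sub, add_dotProduct, sub_dotProduct] at h1 h2 h3 h4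
  constructor <;> linarith

lemma relax_compact (d k : ℕ) : IsCompact (relaxSet d k) := by
  have hc : IsCompact (Set.univ.pi fun _ : Fin d => Set.univ.pi fun _ : Fin d =>
      Set.Icc (-1 : ℝ) 1) :=
    isCompact_univ_pi fun _ => isCompact_univ_pi fun _ => isCompact_Icc
  refine hc.of_isClosed_subset ?_ ?_
  · have h1 : IsClosed {M : Matrix (Fin d) (Fin d) ℝ | (1 - M).PosSemidef} :=
      psd_closed.preimage (f := fun M : Matrix (Fin d) (Fin d) ℝ => 1 - M) (by fun_prop)
    have h2 : IsClosed {M : Matrix (Fin d) (Fin d) ℝ | M.trace = (k : ℝ)} :=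
      isClosed_eq (by fun_prop) continuous_const
    exact psd_closed.inter (h1.inter h2)
  · intro M hM i _ j _
    exact relax_entry hM i j

lemma relax_convex (d k : ℕ) {M M' : Matrix (Fin d) (Fin d) ℝ} (hM : M ∈ relaxSet d k)
    (hM' : M' ∈ relaxSet d k) (t : ℝ) (h0 : 0 ≤ t) (h1 : t ≤ 1) :
    (1 - t) • M + t • M' ∈ relaxSet d k := by
  have h1' : 0 ≤ 1 - t := by linarith
  refine ⟨(hM.1.smul h1').add (hM'.1.smul h0), ?_, ?_⟩
  · have e : 1 - ((1 - t) • M + t • M') = (1 - t) • (1 - M) + t • (1 - M') := by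
      simp only [smul_sub, sub_smul, one_smul]; abel
    rw [e]
    exact (hM.2.1.smul h1').add (hM'.2.1.smul h0)
  · rw [trace_add, trace_smul, trace_smul, hM.2.2, hM'.2.2]; simp; ring

lemma part1 {d n k : ℕ} (hn : 0 < n) (hk : 0 < k) (hkd : k ≤ d) (ρ e : ℝ) (hρ : 0 < ρ)
    (he : 0 < e) (he1 : e ≤ 1 / 2) (z : Fin n → Fin d → ℝ)
    (hz : ∀ V ∈ projSet d k, ∑ i, vnorm (V.mulVec (z i)) ≤ n * ρ) :
    ∃ I : Finset (Fin n), (1 - e) * (n : ℝ) ≤ (I.card : ℝ) ∧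
      ∀ M ∈ relaxSet d k,
        (I.card : ℝ)⁻¹ * ∑ i ∈ I, (z i) ⬝ᵥ M.mulVec (z i) ≤ 144 * ρ ^ 2 / e := by
  have hn' : (0:ℝ) < n := by exact_mod_cast hn
  set δ : ℝ := 6 * ρ / e with hδ
  have hδ0 : 0 < δ := by positivity
  have hne : (relaxSet d k).Nonempty := by
    obtain ⟨K, -, hK⟩ := Finset.exists_subset_card_eq (s := (Finset.univ : Finset (Fin d)))
      (n := k) (by simpa using hkd)
    exact ⟨_, proj_relax (mk_proj 1 (by simp) K hK)⟩
  obtain ⟨P, hP, hmax⟩ := (relax_compact d k).exists_isMaxOn hne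
    (f := fun M => ∑ i, Real.sqrt (z i ⬝ᵥ M.mulVec (z i) + δ ^ 2))
    (Continuous.continuousOn (continuous_finsetSum _ fun i _ =>
      Real.continuous_sqrt.comp ((quad_continuous (z i)).add continuous_const)))
  set q : Fin n → ℝ := fun i => z i ⬝ᵥ P.mulVec (z i) with hq
  have hq0 : ∀ i, 0 ≤ q i := fun i => quad_nonneg hP _
  have hqs : ∑ i, Real.sqrt (q i) ≤ 6 * (n * ρ) := rounding hk hkd z _ hz hP
  have hr0 : ∀ i, 0 < Real.sqrt (q i + δ ^ 2) := fun i =>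
    Real.sqrt_pos.2 (by have := hq0 i; positivity)
  have hfo : ∀ M ∈ relaxSet d k, ∑ i, (z i ⬝ᵥ M.mulVec (z i)) / Real.sqrt (q i + δ ^ 2) ≤
      6 * (n * ρ) := by
    intro M hM
    have h1 := first_order (fun i => q i + δ ^ 2) (fun i => z i ⬝ᵥ M.mulVec (z i) - q i)
      (fun i => by have := hq0 i; positivity) (by
        intro t ht0 ht1
        have h2 := hmax (relax_convex d k hP hM t ht0.le ht1)
        refine le_trans (le_of_eq ?_) h2
        refine Finset.sum_congr rfl fun i _ => ?_
        congr 1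
        simp only [add_mulVec, smul_mulVec, dotProduct_add, dotProduct_smul, smul_eq_mul, hq]
        ring)
    simp only [sub_div, Finset.sum_sub_distrib] at h1
    have h3 : ∑ i, q i / Real.sqrt (q i + δ ^ 2) ≤ ∑ i, Real.sqrt (q i) := by
      refine Finset.sum_le_sum fun i _ => ?_
      rw [div_le_iff₀ (hr0 i)]
      have h4 : Real.sqrt (q i) ≤ Real.sqrt (q i + δ ^ 2) :=
        Real.sqrt_le_sqrt (by have := sq_nonneg δ; linarith)
      nlinarith [Real.mul_self_sqrt (hq0 i), Real.sqrt_nonneg (q i)]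
    linarith
  set I : Finset (Fin n) := Finset.univ.filter (fun i => Real.sqrt (q i) ≤ δ) with hI
  have hcard : (1 - e) * (n : ℝ) ≤ (I.card : ℝ) := by
    have h1 : ((Finset.univ.filter (fun i => ¬ Real.sqrt (q i) ≤ δ)).card : ℝ) * δ ≤
        6 * (n * ρ) := by
      refine le_trans ?_ hqs
      calc _ = ∑ i ∈ Finset.univ.filter (fun i => ¬ Real.sqrt (q i) ≤ δ), δ := by simp
        _ ≤ ∑ i ∈ Finset.univ.filter (fun i => ¬ Real.sqrt (q i) ≤ δ), Real.sqrt (q i) :=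
          Finset.sum_le_sum fun i hi => (not_le.1 (Finset.mem_filter.1 hi).2).le
        _ ≤ _ := Finset.sum_le_sum_of_subset_of_nonneg (Finset.subset_univ _)
          fun i _ _ => Real.sqrt_nonneg _
    have h2 : (I.card : ℝ) + ((Finset.univ.filter (fun i => ¬ Real.sqrt (q i) ≤ δ)).card : ℝ)
        = n := by
      have := Finset.card_filter_add_card_filter_not (s := (Finset.univ : Finset (Fin n)))
        (fun i => Real.sqrt (q i) ≤ δ)
      rw [Finset.card_univ, Fintype.card_fin] at this
      exact_mod_cast this
    have h3 : 6 * (n * ρ) = e * n * δ := by rw [hδ]; field_simp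
    rw [h3] at h1
    have := le_of_mul_le_mul_right h1 hδ0
    linarith
  refine ⟨I, hcard, fun M hM => ?_⟩
  have hIc : (n : ℝ) / 2 ≤ I.card := by nlinarith
  have hIpos : (0:ℝ) < I.card := by linarith
  have hsum : ∑ i ∈ I, (z i) ⬝ᵥ M.mulVec (z i) ≤ 2 * δ * (6 * (n * ρ)) := by
    have h1 := hfo M hM
    calc _ ≤ ∑ i ∈ I, 2 * δ * ((z i ⬝ᵥ M.mulVec (z i)) / Real.sqrt (q i + δ ^ 2)) := by
          refine Finset.sum_le_sum fun i hi => ?_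
          have h2 : Real.sqrt (q i) ≤ δ := (Finset.mem_filter.1 hi).2
          have h3 : Real.sqrt (q i + δ ^ 2) ≤ 2 * δ := by
            apply Real.sqrt_le_iff.2 ⟨by positivity, ?_⟩
            have h4 := Real.sqrt_le_iff.1 h2
            nlinarith [h4.2]
          rw [mul_div_assoc', le_div_iff₀ (hr0 i)]
          have := quad_nonneg hM (z i)
          nlinarith
      _ ≤ ∑ i, 2 * δ * ((z i ⬝ᵥ M.mulVec (z i)) / Real.sqrt (q i + δ ^ 2)) :=
          Finset.sum_le_sum_of_subset_of_nonneg (Finset.subset_univ _) fun i _ _ =>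
            mul_nonneg (by positivity) (div_nonneg (quad_nonneg hM _) (hr0 i).le)
      _ = 2 * δ * ∑ i, ((z i ⬝ᵥ M.mulVec (z i)) / Real.sqrt (q i + δ ^ 2)) :=
          (Finset.mul_sum _ _ _).symm
      _ ≤ _ := mul_le_mul_of_nonneg_left h1 (by positivity)
  rw [inv_mul_le_iff₀ hIpos]
  refine hsum.trans ?_
  have e1 : 2 * δ * (6 * (n * ρ)) = (n / 2) * (144 * ρ ^ 2 / e) := by
    rw [hδ]; field_simp; ring
  rw [e1]
  exact mul_le_mul_of_nonneg_right hIc (by positivity)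

end Aux1

/-- existence of a large subset of locally bounded perturbations with
bounded second moment in every direction of `M_k`, and the equality of the two maxima. -/
theorem stmt_1 :
    ∃ C : ℝ, 0 < C ∧
      ∀ (d n k : ℕ), 0 < d → 0 < n → 0 < k → k ≤ d →
        ∀ (ρ ε : ℝ), 0 < ρ → 0 < ε → ε < 1 →
          ∀ z : Fin n → Fin d → ℝ,
            (∀ V ∈ projSet d k, (n : ℝ)⁻¹ * ∑ i, vnorm (V.mulVec (z i)) ≤ ρ) →
            ((∃ I : Finset (Fin n), (1 - ε) * (n : ℝ) ≤ (I.card : ℝ) ∧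
                ∀ M ∈ relaxSet d k,
                  (I.card : ℝ)⁻¹ * ∑ i ∈ I, (z i) ⬝ᵥ M.mulVec (z i) ≤ C * ρ ^ 2 / ε) ∧
              ∀ I : Finset (Fin n),
                (⨆ V ∈ projSet d k, (I.card : ℝ)⁻¹ * ∑ i ∈ I, vnorm (V.mulVec (z i)) ^ 2) =
                  ⨆ M ∈ relaxSet d k, (I.card : ℝ)⁻¹ * ∑ i ∈ I, (z i) ⬝ᵥ M.mulVec (z i)) := by
  refine ⟨288, by norm_num, ?_⟩
  intro d n k hd hn hk hkd ρ ε hρ hε hε1 z hz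
  refine ⟨?_, fun I => Aux1.part2 hk hkd z I⟩
  have hn' : (0:ℝ) < n := by exact_mod_cast hn
  obtain ⟨I, hI, h⟩ := Aux1.part1 hn hk hkd ρ (ε / 2) hρ (by linarith) (by linarith) z
    (fun V hV => by
      have := hz V hV
      rwa [inv_mul_le_iff₀ hn'] at this)
  refine ⟨I, ?_, fun M hM => (h M hM).trans (le_of_eq ?_)⟩
  · nlinarith
  · field_simp; ring

end
end

section
/- There is a universal constant C > 0 such that the following holds. Let Σ be a d×d positive definite matrix, 0 < ε < 1/2, δ ≥ ε, and let x_1,…,x_n ∈ ℝ^d be such that the multiset {Σ^{−1/2} x_1, …, Σ^{−1/2} x_n} is (ε,δ)-stable with respect to μ = 0. Then the multiset {x_1,…,x_n} is (ε,γ)-PCA-stable with respect to Σ for some γ ≤ C δ²/ε. -/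
open Matrix Finset

noncomputable section

theorem vnorm_sq {d : ℕ} (x : Fin d → ℝ) : vnorm x ^ 2 = x ⬝ᵥ x := by
  unfold vnorm
  rw [Real.sq_sqrt (Finset.sum_nonneg fun i _ => sq_nonneg _)]
  simp [dotProduct, sq]

theorem vnorm_nonneg {d : ℕ} (x : Fin d → ℝ) : 0 ≤ vnorm x := Real.sqrt_nonneg _

theorem dot_sq_le {d : ℕ} (x y : Fin d → ℝ) : (x ⬝ᵥ y) ^ 2 ≤ (x ⬝ᵥ x) * (y ⬝ᵥ y) := by
  have := Finset.sum_mul_sq_le_sq_mul_sq Finset.univ x y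
  simpa [dotProduct, sq] using this

theorem vnorm_mulVec_le {d : ℕ} (A : Matrix (Fin d) (Fin d) ℝ) (x : Fin d → ℝ)
    (hx : vnorm x = 1) : vnorm (A.mulVec x) ≤ Real.sqrt (∑ i, (A i) ⬝ᵥ (A i)) := by
  unfold vnorm
  apply Real.sqrt_le_sqrt
  apply Finset.sum_le_sum
  intro i _
  have h := dot_sq_le (A i) x
  have h2 := vnorm_sq x
  rw [hx] at h2
  rw [← h2] at h
  simpa [mulVec] using h

theorem opNorm_quad {d : ℕ} (A : Matrix (Fin d) (Fin d) ℝ) (r : ℝ) (h : opNorm A ≤ r)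
    (u : Fin d → ℝ) : |u ⬝ᵥ A.mulVec u| ≤ r * (u ⬝ᵥ u) := by
  by_cases hu : vnorm u = 0
  · have h1 := vnorm_sq u
    rw [hu] at h1
    have h2 : u = 0 := dotProduct_self_eq_zero.1 (by rw [← h1]; norm_num)
    subst h2
    simp
  · have hpos : 0 < vnorm u := lt_of_le_of_ne (vnorm_nonneg u) (Ne.symm hu)
    have hn := vnorm_sq u
    set t := vnorm u with ht
    set y : Fin d → ℝ := t⁻¹ • u with hy
    have hyu : u = t • y := by rw [hy, smul_smul, mul_inv_cancel₀ hu, one_smul]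
    have hy2 : y ⬝ᵥ y = 1 := by
      rw [hy, dotProduct_smul, smul_dotProduct, ← hn, smul_eq_mul, smul_eq_mul]
      field_simp
    have hy1 : vnorm y = 1 := by
      have := vnorm_sq y
      rw [hy2] at this
      nlinarith [vnorm_nonneg y]
    have hb : vnorm (A.mulVec y) ≤ r := by
      refine le_trans ?_ h
      unfold opNorm
      refine le_csSup ⟨Real.sqrt (∑ i, (A i) ⬝ᵥ (A i)), ?_⟩ ⟨y, hy1, rfl⟩
      rintro _ ⟨z, hz, rfl⟩
      exact vnorm_mulVec_le A z hz
    have hc := dot_sq_le y (A.mulVec y)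
    rw [hy2, one_mul, ← vnorm_sq] at hc
    have hd : |y ⬝ᵥ A.mulVec y| ≤ r :=
      le_trans (abs_le_of_sq_le_sq hc (vnorm_nonneg _)) hb
    have he : u ⬝ᵥ A.mulVec u = t ^ 2 * (y ⬝ᵥ A.mulVec y) := by
      rw [hyu, mulVec_smul, dotProduct_smul, smul_dotProduct, smul_eq_mul, smul_eq_mul]
      ring
    rw [he, abs_mul, abs_of_nonneg (sq_nonneg t), ← hn, mul_comm]
    exact mul_le_mul_of_nonneg_right hd (sq_nonneg t)

theorem quad_sum {d : ℕ} (S : Multiset (Fin d → ℝ)) (m v : Fin d → ℝ) :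
    v ⬝ᵥ ((S.map (fun x => outerProd (x - m))).sum).mulVec v
      = (S.map (fun x => (v ⬝ᵥ x - v ⬝ᵥ m) ^ 2)).sum := by
  induction S using Multiset.induction with
  | empty => simp
  | cons a S ih =>
    simp only [Multiset.map_cons, Multiset.sum_cons, add_mulVec, dotProduct_add, ih]
    congr 1
    unfold outerProd
    rw [vecMulVec_mulVec, op_smul_eq_smul, dotProduct_smul, dotProduct_comm (a - m) v,
      dotProduct_sub, smul_eq_mul]
    ring

theorem sum_center {d : ℕ} (S : Multiset (Fin d → ℝ)) (v : Fin d → ℝ) (b : ℝ) :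
    (S.map (fun x => (v ⬝ᵥ x - b) ^ 2)).sum
      = (S.map (fun x => (v ⬝ᵥ x) ^ 2)).sum - 2 * b * (v ⬝ᵥ S.sum) + S.card * b ^ 2 := by
  induction S using Multiset.induction with
  | empty => simp
  | cons a S ih =>
    simp only [Multiset.map_cons, Multiset.sum_cons, Multiset.card_cons, dotProduct_add, ih]
    push_cast
    ring

theorem quad_outer {d : ℕ} (S : Multiset (Fin d → ℝ)) (v : Fin d → ℝ) :
    v ⬝ᵥ ((S.map outerProd).sum).mulVec v = (S.map (fun x => (v ⬝ᵥ x) ^ 2)).sum := by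
  have := quad_sum S 0 v
  simpa using this

theorem outer_herm {d : ℕ} (S : Multiset (Fin d → ℝ)) :
    ((S.map outerProd).sum).IsHermitian := by
  induction S using Multiset.induction with
  | empty => simp
  | cons a S ih =>
    rw [Multiset.map_cons, Multiset.sum_cons]
    refine IsHermitian.add ?_ ih
    ext i j
    simp [outerProd, vecMulVec_apply, mul_comm]

theorem stable_quad {d : ℕ} (T : Multiset (Fin d → ℝ)) (ε δ : ℝ) (hε : 0 < ε) (hε2 : ε < 1 / 2)
    (hδ : ε ≤ δ) (h1 : vnorm (mmean T - 0) ≤ δ) (h2 : opNorm (scov T - 1) ≤ δ ^ 2 / ε)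
    (u : Fin d → ℝ) :
    |(T.card : ℝ)⁻¹ * (T.map (fun x => (u ⬝ᵥ x) ^ 2)).sum - u ⬝ᵥ u|
      ≤ (2 * δ ^ 2 / ε) * (u ⬝ᵥ u) := by
  have hq := opNorm_quad _ _ h2 u
  rw [sub_mulVec, one_mulVec, dotProduct_sub, scov, smom, smul_mulVec, dotProduct_smul,
    quad_sum, sum_center] at hq
  have hm := dot_sq_le u (mmean T)
  have hmm : mmean T ⬝ᵥ mmean T ≤ δ ^ 2 := by
    rw [sub_zero] at h1
    rw [← vnorm_sq]
    exact pow_le_pow_left₀ (vnorm_nonneg _) h1 2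
  have huu : 0 ≤ u ⬝ᵥ u := by rw [← vnorm_sq]; positivity
  have hm2 : (u ⬝ᵥ mmean T) ^ 2 ≤ δ ^ 2 / ε * (u ⬝ᵥ u) := by
    have : δ ^ 2 ≤ δ ^ 2 / ε := by
      rw [le_div_iff₀ hε]
      nlinarith [sq_nonneg δ]
    calc _ ≤ _ := hm
      _ ≤ (u ⬝ᵥ u) * (δ ^ 2 / ε) := mul_le_mul_of_nonneg_left (hmm.trans this) huu
      _ = _ := mul_comm _ _
  have key : (T.card : ℝ)⁻¹ • ((T.map (fun x => (u ⬝ᵥ x) ^ 2)).sum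
      - 2 * (u ⬝ᵥ mmean T) * (u ⬝ᵥ T.sum) + T.card * (u ⬝ᵥ mmean T) ^ 2)
      = (T.card : ℝ)⁻¹ * (T.map (fun x => (u ⬝ᵥ x) ^ 2)).sum - (u ⬝ᵥ mmean T) ^ 2 := by
    have hd : u ⬝ᵥ mmean T = (T.card : ℝ)⁻¹ * (u ⬝ᵥ T.sum) := by
      rw [mmean, dotProduct_smul, smul_eq_mul]
    rw [hd, smul_eq_mul]
    by_cases hc : (T.card : ℝ) = 0
    · rw [hc]; simp
    · field_simp
      ring
  rw [key] at hq
  rw [abs_le] at hq ⊢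
  have e : 2 * δ ^ 2 / ε * (u ⬝ᵥ u) = δ ^ 2 / ε * (u ⬝ᵥ u) + δ ^ 2 / ε * (u ⬝ᵥ u) := by ring
  have := sq_nonneg (u ⬝ᵥ mmean T)
  constructor <;> linarith [hq.1, hq.2]

/-- if the whitened data `{Σ^{-1/2} x_i}` is `(ε,δ)`-stable with respect
to `0`, then `{x_i}` is `(ε,γ)`-PCA-stable with respect to `Σ` for some `γ ≤ Cδ²/ε`.
Here `W` denotes the (unique) PSD square root of `Σ⁻¹`, i.e. `W = Σ^{-1/2}`. -/
theorem stmt_14 :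
    ∃ C : ℝ, 0 < C ∧
      ∀ (d n : ℕ) (ε δ : ℝ) (Sg : Matrix (Fin d) (Fin d) ℝ), Sg.PosDef →
        0 < ε → ε < 1 / 2 → ε ≤ δ →
        ∀ x : Fin n → Fin d → ℝ,
          ∀ W : Matrix (Fin d) (Fin d) ℝ, W.PosSemidef → W * W = Sg⁻¹ →
            Stable ε δ (mset (fun i => W.mulVec (x i))) 0 →
            ∃ γ : ℝ, γ ≤ C * δ ^ 2 / ε ∧ PCAStable ε γ (mset x) Sg := by
  refine ⟨2, by norm_num, ?_⟩
  intro d n ε δ Sg hSg hε hε2 hδ x W hW hWW hst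
  refine ⟨2 * δ ^ 2 / ε, le_rfl, ?_⟩
  intro S hS hcard
  have hT : S.map W.mulVec ≤ mset (fun i => W.mulVec (x i)) := by
    have := Multiset.map_le_map (f := W.mulVec) hS
    simpa [mset, Multiset.map_map, Function.comp_def] using this
  have hst' := hst (S.map W.mulVec) hT (by simpa [mset] using hcard)
  have hdet : IsUnit Sg.det := hSg.det_pos.ne'.isUnit
  have hWS : W * (W * Sg) = 1 := by
    rw [← mul_assoc, hWW, nonsing_inv_mul _ hdet]
  have hSW : (W * Sg) * W = 1 := mul_eq_one_comm.1 hWS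
  have hWt : Wᵀ = W := by
    have := hW.1.eq
    rwa [conjTranspose_eq_transpose_of_trivial] at this
  have main : ∀ v : Fin d → ℝ,
      |(S.card : ℝ)⁻¹ * (S.map (fun x => (v ⬝ᵥ x) ^ 2)).sum - v ⬝ᵥ Sg.mulVec v|
      ≤ (2 * δ ^ 2 / ε) * (v ⬝ᵥ Sg.mulVec v) := by
    intro v
    have h := stable_quad _ ε δ hε hε2 hδ hst'.1 hst'.2 ((W * Sg).mulVec v)
    have hadj : ∀ a b : Fin d → ℝ, a ⬝ᵥ W.mulVec b = W.mulVec a ⬝ᵥ b := by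
      intro a b
      rw [dotProduct_mulVec, ← mulVec_transpose, hWt]
    have e1 : W.mulVec ((W * Sg).mulVec v) = v := by
      rw [mulVec_mulVec, hWS, one_mulVec]
    have e2 : (W * Sg).mulVec v ⬝ᵥ (W * Sg).mulVec v = v ⬝ᵥ Sg.mulVec v := by
      conv_lhs => rw [← mulVec_mulVec v W Sg, hadj, mulVec_mulVec v W Sg, e1]
    rw [e2] at h
    simpa only [Multiset.card_map, Multiset.map_map, Function.comp_def, hadj, e1] using h
  have hH := outer_herm S
  have hH' : ((S.card : ℝ)⁻¹ • (S.map outerProd).sum).IsHermitian := by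
    unfold IsHermitian at *
    rw [conjTranspose_smul, hH]; simp
  have hG : ∀ c : ℝ, (c • Sg).IsHermitian := by
    intro c
    have := hSg.1
    unfold IsHermitian at *
    rw [conjTranspose_smul, this]; simp
  constructor
  · refine PosSemidef.of_dotProduct_mulVec_nonneg (hH'.sub (hG _)) fun v => ?_
    have := abs_le.1 (main v)
    rw [star_trivial, sub_mulVec, dotProduct_sub, smul_mulVec, smul_mulVec, dotProduct_smul,
      dotProduct_smul, quad_outer, smul_eq_mul, smul_eq_mul]
    linarith [this.1]
  · refine PosSemidef.of_dotProduct_mulVec_nonneg ((hG _).sub hH') fun v => ?_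
    have := abs_le.1 (main v)
    rw [star_trivial, sub_mulVec, dotProduct_sub, smul_mulVec, smul_mulVec, dotProduct_smul,
      dotProduct_smul, quad_outer, smul_eq_mul, smul_eq_mul]
    linarith [this.2]

end
end

section
/- There is a universal constant C > 0 such that the following holds. Let ε ∈ (0,1/2), k ≤ d, let y_1,…,y_n ∈ ℝ^d, let μ ∈ ℝ^d, and let w ∈ Δ_{n,ε}. Define Σ̄_w = ∑_{i=1}^n w_i (y_i − μ)(y_i − μ)ᵀ. Then there exists a subset I ⊆ {1,…,n} with |I| ≥ (1−2ε)n such that, writing Σ̄_I = (1/|I|)∑_{i∈I}(y_i − μ)(y_i − μ)ᵀ, one has ⟨M, Σ̄_I⟩ ≤ C ⟨M, Σ̄_w⟩ for every M ∈ M_k. -/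
open Matrix Finset

noncomputable section

theorem finner_outer_nonneg {d : ℕ} {M : Matrix (Fin d) (Fin d) ℝ} (hM : M.PosSemidef)
    (x : Fin d → ℝ) : 0 ≤ finner M (outerProd x) := by
  have h := hM.dotProduct_mulVec_nonneg x
  have e : finner M (outerProd x) = star x ⬝ᵥ M.mulVec x := by
    simp only [finner, outerProd, Matrix.trace, Matrix.diag, Matrix.mul_apply, Matrix.transpose_apply,
      Matrix.vecMulVec_apply, dotProduct, Matrix.mulVec, star_trivial, Finset.mul_sum]
    refine Finset.sum_congr rfl fun i _ => Finset.sum_congr rfl fun j _ => ?_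
    ring
  rw [e]; exact h

theorem finner_smul' {d : ℕ} (M A : Matrix (Fin d) (Fin d) ℝ) (c : ℝ) :
    finner M (c • A) = c * finner M A := by
  simp [finner]

theorem finner_sum' {d : ℕ} {ι : Type*} (M : Matrix (Fin d) (Fin d) ℝ) (s : Finset ι)
    (f : ι → Matrix (Fin d) (Fin d) ℝ) :
    finner M (∑ i ∈ s, f i) = ∑ i ∈ s, finner M (f i) := by
  simp [finner, Matrix.transpose_sum, Matrix.mul_sum, Matrix.trace_sum]

/-- rounding a fractional weight vector `w ∈ Δ_{n,ε}` to a large index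
subset whose centered second moment is dominated, in every direction of `M_k`, by that
of the weighted second moment. -/
theorem stmt_15 :
    ∃ C : ℝ, 0 < C ∧
      ∀ (d n k : ℕ) (ε : ℝ), 0 < ε → ε < 1 / 2 → k ≤ d →
        ∀ (y : Fin n → Fin d → ℝ) (μ : Fin d → ℝ) (w : Fin n → ℝ),
          w ∈ simplexEps n ε →
          ∃ I : Finset (Fin n), (1 - 2 * ε) * (n : ℝ) ≤ (I.card : ℝ) ∧
            ∀ M ∈ relaxSet d k,
              finner M ((I.card : ℝ)⁻¹ • ∑ i ∈ I, outerProd (y i - μ)) ≤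
                C * finner M (∑ i, w i • outerProd (y i - μ)) := by
  refine ⟨6, by norm_num, ?_⟩
  intro d n k ε h0 h1 _ y μ w hw
  obtain ⟨hw0, hw1, hw2⟩ := hw
  have hn : 0 < n := by
    rcases Nat.eq_zero_or_pos n with rfl | h
    · simp at hw1
    · exact h
  have hnR : (0 : ℝ) < n := by exact_mod_cast hn
  have h1e : 0 < 1 - ε := by linarith
  set I : Finset (Fin n) := Finset.univ.filter (fun i => 1 / (2 * (n : ℝ)) ≤ w i) with hI
  have hsum : (1 : ℝ) ≤ I.card * (1 / ((1 - ε) * n)) + (n - I.card) * (1 / (2 * n)) := by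
    refine hw1.symm.le.trans ?_
    rw [← Finset.sum_filter_add_sum_filter_not Finset.univ
      (fun i => 1 / (2 * (n : ℝ)) ≤ w i) w]
    have hc : ((Finset.univ.filter (fun i => ¬ 1 / (2 * (n : ℝ)) ≤ w i)).card : ℝ)
        = n - I.card := by
      have h := Finset.card_filter_add_card_filter_not (s := (Finset.univ : Finset (Fin n)))
        (fun i => 1 / (2 * (n : ℝ)) ≤ w i)
      rw [Finset.card_univ, Fintype.card_fin] at h
      rw [eq_sub_iff_add_eq, hI, add_comm]
      exact_mod_cast h
    apply add_le_add
    · rw [← nsmul_eq_mul]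
      exact Finset.sum_le_card_nsmul _ _ _ fun i _ => hw2 i
    · rw [← hc, ← nsmul_eq_mul]
      refine Finset.sum_le_card_nsmul _ _ _ fun i hi => ?_
      exact le_of_lt (not_le.mp (Finset.mem_filter.mp hi).2)
  have hkey : 2 * (1 - ε) * (n : ℝ) ≤ 2 * I.card + (n - I.card) * (1 - ε) := by
    have e : (I.card : ℝ) * (1 / ((1 - ε) * n)) + (n - I.card) * (1 / (2 * n))
        = (2 * I.card + (n - I.card) * (1 - ε)) / (2 * (1 - ε) * n) := by
      field_simp
    rw [e, le_div_iff₀ (by positivity)] at hsum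
    linarith
  have hcard : (I.card : ℝ) ≤ n := by
    have := Finset.card_le_univ I
    rw [Fintype.card_fin] at this
    exact_mod_cast this
  -- (1 + ε) * |I| ≥ (1 - ε) * n
  have hkey2 : (1 - ε) * (n : ℝ) ≤ (1 + ε) * I.card := by linarith
  have h3 : (n : ℝ) ≤ 3 * I.card := by
    have hc0 : (0 : ℝ) ≤ I.card := by positivity
    nlinarith
  have hIpos : (0 : ℝ) < I.card := by linarith
  refine ⟨I, ?_, ?_⟩
  · have : (1 + ε) * ((1 - 2 * ε) * (n : ℝ)) ≤ (1 + ε) * I.card := by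
      nlinarith [mul_pos (mul_pos h0 h0) hnR]
    exact le_of_mul_le_mul_left this (by linarith)
  · intro M hM
    have hq := fun i => finner_outer_nonneg hM.1 (y i - μ)
    rw [finner_smul', finner_sum', finner_sum']
    simp only [finner_smul']
    have hA : ∑ i ∈ I, finner M (outerProd (y i - μ))
        ≤ 2 * n * ∑ i, w i * finner M (outerProd (y i - μ)) := by
      rw [Finset.mul_sum]
      refine le_trans (Finset.sum_le_sum (g := fun i =>
        2 * n * (w i * finner M (outerProd (y i - μ)))) fun i hi => ?_) ?_
      · have h := (Finset.mem_filter.mp hi).2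
        rw [div_le_iff₀ (by positivity)] at h
        nlinarith [mul_le_mul_of_nonneg_right h (hq i)]
      · refine Finset.sum_le_sum_of_subset_of_nonneg (Finset.subset_univ _) fun i _ _ => ?_
        have := mul_nonneg (hw0 i) (hq i)
        positivity
    have hB : 0 ≤ ∑ i, w i * finner M (outerProd (y i - μ)) :=
      Finset.sum_nonneg fun i _ => mul_nonneg (hw0 i) (hq i)
    rw [inv_mul_le_iff₀ hIpos]
    nlinarith [mul_le_mul_of_nonneg_right h3 hB]

end
end
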